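/- arXiv:1208.3017 — 6 statements merged into one kernel-verified Lean document; each statement's English description precedes it below -/
import Mathlib

section
/- Let M be a k×n matrix over the field F_2, let X^n be uniformly distributed on F_2^n, and let S = X^n M^T. Let Z^n be the output of n independent uses of a binary erasure channel BEC(ε) with input X^n (each Z_i equals X_i with probability 1−ε and equals the erasure symbol ? with probability ε, independently). Then for every output sequence z^n, the conditional Shannon entropy (in nats) of S given Z^n = z^n satisfies H(S | Z^n = z^n) ≥ rank(M_{J(z^n)}) · log 2, where J(z^n) ⊆ {1,…,n} is the set of indices j with z_j = ? and M_J denotes the submatrix of M consisting of the columns indexed by J. -/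
open scoped BigOperators

/-- Joint pmf of the uniform input `x` on `F_2^n` and the output `z` of `n` independent
uses of a binary erasure channel with erasure probability `ε`
(`none` is the erasure symbol `?`). -/
noncomputable def becJoint (n : ℕ) (ε : ℝ) (x : Fin n → ZMod 2)
    (z : Fin n → Option (ZMod 2)) : ℝ :=
  (1 / 2 ^ n) * ∏ i, (if z i = some (x i) then 1 - ε else if z i = none then ε else 0)

/-- Conditional Shannon entropy (in nats) of `S = X M^T` given `Z^n = z`, where
`X` is uniform on `F_2^n` and `Z^n` is the output of the BEC(ε) with input `X`. -/
noncomputable def condEntGiven (k n : ℕ) (M : Matrix (Fin k) (Fin n) (ZMod 2)) (ε : ℝ)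
    (z : Fin n → Option (ZMod 2)) : ℝ :=
  ∑ s : Fin k → ZMod 2,
    Real.negMulLog
      ((∑ x ∈ Finset.univ.filter fun x => M.mulVec x = s, becJoint n ε x z) /
        (∑ x, becJoint n ε x z))

open Finset

/-- A probability vector with all entries at most `b` has entropy at least `-log b`. -/
theorem neg_log_le_sum_negMulLog {ι : Type*} [Fintype ι] {p : ι → ℝ} {b : ℝ}
    (hp : ∀ i, 0 ≤ p i) (hsum : ∑ i, p i = 1) (hb : ∀ i, p i ≤ b) :
    -Real.log b ≤ ∑ i, Real.negMulLog (p i) := by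
  have h : ∀ i, p i * -Real.log b ≤ Real.negMulLog (p i) := by
    intro i
    rcases (hp i).eq_or_lt with h0 | h0
    · simp [← h0]
    · rw [Real.negMulLog_eq_neg]
      have := mul_le_mul_of_nonneg_left (Real.log_le_log h0 (hb i)) h0.le
      linarith
  calc -Real.log b = ∑ i, p i * -Real.log b := by rw [← Finset.sum_mul, hsum, one_mul]
    _ ≤ _ := Finset.sum_le_sum fun i _ => h i

/-- If a nonnegative weight is invariant under translation by a set of lifts of a finite set `U`
of values of an additive map `g`, then the weight of each fibre of `g` is at most a fraction
`1 / #U` of the total. -/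
theorem card_mul_sum_fiber_le_sum {G H : Type*} [AddCommGroup G] [Fintype G] [AddCommGroup H]
    [DecidableEq H] (g : G →+ H) (f : G → ℝ) (hf : ∀ x, 0 ≤ f x) (U : Finset H)
    (hU : ∀ u ∈ U, ∃ w, g w = u ∧ ∀ x, f (x + w) = f x) (s : H) :
    (#U : ℝ) * ∑ x with g x = s, f x ≤ ∑ x, f x := by
  have hshift : ∀ u ∈ U, ∑ x with g x = s + u, f x = ∑ x with g x = s, f x := by
    intro u hu
    obtain ⟨w, hw, hinv⟩ := hU u hu
    symm
    refine Finset.sum_equiv (Equiv.addRight w) (fun x => ?_) fun x _ => (hinv x).symm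
    simp [hw]
  calc (#U : ℝ) * ∑ x with g x = s, f x = ∑ u ∈ U, ∑ x with g x = s + u, f x := by
        rw [Finset.sum_congr rfl hshift, Finset.sum_const, nsmul_eq_mul]
    _ = ∑ u ∈ U.image (s + ·), ∑ x with g x = u, f x := by
        rw [Finset.sum_image fun a _ b _ h => add_left_cancel h]
    _ ≤ ∑ x, f x := Finset.sum_fiberwise_le_sum_of_sum_fiber_nonneg fun _ _ =>
        Finset.sum_nonneg fun x _ => hf x

theorem becJoint_nonneg {n : ℕ} {ε : ℝ} (hε0 : 0 ≤ ε) (hε1 : ε ≤ 1) (x : Fin n → ZMod 2)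
    (z : Fin n → Option (ZMod 2)) : 0 ≤ becJoint n ε x z := by
  refine mul_nonneg (by positivity) (Finset.prod_nonneg fun i _ => ?_)
  split_ifs <;> linarith

theorem sum_becJoint_pos {n : ℕ} {ε : ℝ} (hε0 : 0 < ε) (hε1 : ε < 1)
    (z : Fin n → Option (ZMod 2)) : 0 < ∑ x, becJoint n ε x z := by
  refine Finset.sum_pos' (fun x _ => becJoint_nonneg hε0.le hε1.le x z)
    ⟨fun i => (z i).getD 0, Finset.mem_univ _, ?_⟩
  refine mul_pos (by positivity) (Finset.prod_pos fun i _ => ?_)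
  cases hz : z i <;> simp [hz, hε0, hε1]

/-- The likelihood of an output does not change when the input is modified at erased positions. -/
theorem becJoint_add_of_erased {n : ℕ} (ε : ℝ) {z : Fin n → Option (ZMod 2)}
    {w : Fin n → ZMod 2} (hw : ∀ i, z i ≠ none → w i = 0) (x : Fin n → ZMod 2) :
    becJoint n ε (x + w) z = becJoint n ε x z := by
  unfold becJoint
  congr 1
  refine Finset.prod_congr rfl fun i _ => ?_
  by_cases h : z i = none
  · simp [h]
  · simp [hw i h]

/-- Every vector in the column space of a column-submatrix is the image of a vector supported on
the selected columns. -/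
theorem Matrix.exists_mulVec_eq_submatrix_mulVec {m ι R : Type*} [Fintype ι]
    [NonUnitalNonAssocSemiring R] (M : Matrix m ι R) (P : ι → Prop) [DecidablePred P]
    (v : {i // P i} → R) :
    ∃ w : ι → R, (∀ i, ¬ P i → w i = 0) ∧
      M.mulVec w = (M.submatrix id (Subtype.val : {i // P i} → ι)).mulVec v := by
  refine ⟨fun i => if h : P i then v ⟨i, h⟩ else 0, fun i hi => by simp [hi], ?_⟩
  ext a
  simp only [Matrix.mulVec, dotProduct, Matrix.submatrix_apply, id]
  rw [← Fintype.sum_subtype_add_sum_subtype P]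
  rw [Finset.sum_eq_zero (s := (Finset.univ : Finset {i // ¬ P i})) fun i _ => by
    simp [i.2], add_zero]
  exact Finset.sum_congr rfl fun i _ => by simp [i.2]

/-- Given `Z^n = z`, each value of `S` has probability at most `2 ^ (-rank M_J)`. -/
theorem two_pow_rank_mul_sum_becJoint_le {k n : ℕ} (M : Matrix (Fin k) (Fin n) (ZMod 2)) {ε : ℝ}
    (hε0 : 0 ≤ ε) (hε1 : ε ≤ 1) (z : Fin n → Option (ZMod 2)) (s : Fin k → ZMod 2) :
    (2 : ℝ) ^ (M.submatrix id (Subtype.val : {i : Fin n // z i = none} → Fin n)).rank *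
      ∑ x with M.mulVec x = s, becJoint n ε x z ≤ ∑ x, becJoint n ε x z := by
  have : DecidablePred (· ∈ (M.submatrix id
    (Subtype.val : {i : Fin n // z i = none} → Fin n)).mulVecLin.range) := Classical.decPred _
  set N := M.submatrix id (Subtype.val : {i : Fin n // z i = none} → Fin n)
  let U : Finset (Fin k → ZMod 2) := {u | u ∈ N.mulVecLin.range}
  have hcard : #U = 2 ^ N.rank := by
    rw [← Fintype.card_subtype, Matrix.rank]
    have := Module.card_eq_pow_finrank (K := ZMod 2) (V := N.mulVecLin.range)
    rw [ZMod.card] at this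
    exact this
  have h := card_mul_sum_fiber_le_sum M.mulVecLin.toAddMonoidHom (becJoint n ε · z)
    (becJoint_nonneg hε0 hε1 · z) U (fun u hu => by
      obtain ⟨v, rfl⟩ := (Finset.mem_filter.mp hu).2
      obtain ⟨w, hw, hMw⟩ := M.exists_mulVec_eq_submatrix_mulVec (z · = none) v
      exact ⟨w, hMw, becJoint_add_of_erased ε hw⟩) s
  rw [hcard, Nat.cast_pow, Nat.cast_ofNat] at h
  exact h

/-- Ozarow–Wyner type bound: for every output sequence `z`,
`H(S | Z^n = z) ≥ rank(M_{J(z)}) · log 2`, where `J(z)` is the set of erased indices. -/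
theorem condEnt_ge_rank_mul_log_two (k n : ℕ) (M : Matrix (Fin k) (Fin n) (ZMod 2))
    (ε : ℝ) (hε0 : 0 < ε) (hε1 : ε < 1) (z : Fin n → Option (ZMod 2)) :
    ((M.submatrix id (Subtype.val : {i : Fin n // z i = none} → Fin n)).rank : ℝ) *
        Real.log 2 ≤ condEntGiven k n M ε z := by
  have hT := sum_becJoint_pos hε0 hε1 z
  have h := neg_log_le_sum_negMulLog (ι := Fin k → ZMod 2)
    (p := fun s => (∑ x with M.mulVec x = s, becJoint n ε x z) / ∑ x, becJoint n ε x z)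
    (b := (2 ^ (M.submatrix id (Subtype.val : {i : Fin n // z i = none} → Fin n)).rank)⁻¹)
    (fun s => div_nonneg (Finset.sum_nonneg fun x _ => becJoint_nonneg hε0.le hε1.le x z) hT.le)
    (by rw [← Finset.sum_div, Finset.sum_fiberwise, div_self hT.ne'])
    (fun s => by
      rw [div_le_iff₀ hT, le_inv_mul_iff₀ (by positivity)]
      exact two_pow_rank_mul_sum_becJoint_le M hε0.le hε1.le z s)
  rwa [Real.log_inv, neg_neg, Real.log_pow] at h
end

section
/- Fix 0 < ε < 1 and 0 ≤ R ≤ log 2. There exists a sequence of k_n × n matrices M_n over F_2 with liminf_{n→∞} (k_n/n) log 2 ≥ R such that the maximum-likelihood decoding error probability P_n := Σ_{J ⊆ {1,…,n}} (1−ε)^{|J|} ε^{n−|J|} · 1[rank((M_n)_{J^c}) < k_n] of the code generated by M_n over a binary erasure channel with erasure probability 1−ε satisfies liminf_{n→∞} −(1/n) log P_n ≥ min{ −p log(1−ε) + (log 2 − R) − h(p) : p ∈ [0,1], h(p) ≥ log 2 − R }, where h(p) = −p log p − (1−p) log(1−p) is the binary entropy in nats. -/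
open scoped BigOperators

/-- Binary entropy function `h(p) = -p log p - (1-p) log (1-p)` (natural logarithm,
with `0 log 0 = 0`). -/
noncomputable def binEnt (p : ℝ) : ℝ :=
  Real.negMulLog p + Real.negMulLog (1 - p)

/-- Maximum-likelihood decoding error probability (ties counted as errors) of the linear
code with generator matrix `M` over a binary erasure channel with erasure probability `δ`:
`Σ_J δ^{|J|} (1-δ)^{n-|J|} · 1[rank(M_{J^c}) < k]`. -/
noncomputable def pmlBEC (k n : ℕ) (M : Matrix (Fin k) (Fin n) (ZMod 2)) (δ : ℝ) : ℝ :=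
  ∑ J : Finset (Fin n),
    δ ^ J.card * (1 - δ) ^ (n - J.card) *
      (if (M.submatrix id (Subtype.val : {i : Fin n // i ∉ J} → Fin n)).rank < k
        then (1:ℝ) else 0)

/-- A matrix over `ZMod 2` whose rank is smaller than its number of rows has a nontrivial
left kernel. -/
theorem exists_ne_zero_vecMul_eq_zero {k : ℕ} {ι : Type*} [Fintype ι]
    (A : Matrix (Fin k) ι (ZMod 2)) (h : A.rank < k) : ∃ x, x ≠ 0 ∧ Matrix.vecMul x A = 0 := by
  by_contra! hx
  have hinj : Function.Injective A.vecMul := by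
    intro u v huv
    by_contra hne
    exact hx (u - v) (sub_ne_zero.2 hne) (by
      rw [Matrix.sub_vecMul]
      exact sub_eq_zero.2 huv)
  have := (Matrix.vecMul_injective_iff.1 hinj).rank_matrix
  simp at this
  omega

/-- The probability that a random set with independent elements, each present with probability
`δ`, contains a fixed set `S`. -/
theorem sum_superset_weight {n : ℕ} (S : Finset (Fin n)) (δ : ℝ) :
    ∑ J : Finset (Fin n), δ ^ J.card * (1 - δ) ^ (n - J.card) * (if S ⊆ J then (1 : ℝ) else 0) =
      δ ^ S.card := by
  have h := Finset.prod_add (fun _ : Fin n => δ) (fun i => if i ∉ S then 1 - δ else 0) Finset.univ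
  have hl : ∏ i : Fin n, (δ + if i ∉ S then 1 - δ else 0) = δ ^ S.card := by
    have : ∀ i : Fin n, (δ + if i ∉ S then 1 - δ else 0) = if i ∈ S then δ else 1 := by
      intro i
      by_cases hi : i ∈ S <;> simp [hi]
    simp_rw [this]
    rw [Finset.prod_ite_mem]
    simp
  rw [← hl, h, Finset.powerset_univ]
  refine Finset.sum_congr rfl fun J _ => ?_
  rw [Finset.prod_const, Finset.prod_ite_zero, Finset.prod_const, Finset.card_sdiff_of_subset
    (Finset.subset_univ J), Finset.card_univ, Fintype.card_fin]
  have hiff : (∀ i ∈ Finset.univ \ J, i ∉ S) ↔ S ⊆ J := by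
    constructor
    · intro hJ i hi
      by_contra hc
      exact hJ i (by simp [hc]) hi
    · intro hJ i hi hS
      simp at hi
      exact hi (hJ hS)
  simp only [hiff]
  split_ifs <;> simp

/-- Union bound for the maximum-likelihood decoding error probability. -/
theorem pmlBEC_le_sum {k n : ℕ} (M : Matrix (Fin k) (Fin n) (ZMod 2)) {δ : ℝ} (h0 : 0 ≤ δ)
    (h1 : δ ≤ 1) :
    pmlBEC k n M δ ≤
      ∑ x with x ≠ (0 : Fin k → ZMod 2), δ ^ hammingNorm (Matrix.vecMul x M) := by
  classical
  have hS : ∀ x : Fin k → ZMod 2, δ ^ hammingNorm (Matrix.vecMul x M) = _ := fun x =>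
    (sum_superset_weight (Finset.univ.filter fun i => Matrix.vecMul x M i ≠ 0) δ).symm
  rw [Finset.sum_congr rfl fun x _ => hS x, Finset.sum_comm, pmlBEC]
  refine Finset.sum_le_sum fun J _ => ?_
  rw [← Finset.mul_sum]
  have hw : 0 ≤ δ ^ J.card * (1 - δ) ^ (n - J.card) := by
    have := sub_nonneg.2 h1
    positivity
  refine mul_le_mul_of_nonneg_left ?_ hw
  have hnn : ∀ x ∈ Finset.univ.filter (fun x : Fin k → ZMod 2 => x ≠ 0), (0 : ℝ) ≤
      if (Finset.univ.filter fun i => Matrix.vecMul x M i ≠ 0) ⊆ J then (1 : ℝ) else 0 :=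
    fun x _ => by split_ifs <;> simp
  split_ifs with hr
  · obtain ⟨x, hx, hxM⟩ := exists_ne_zero_vecMul_eq_zero _ hr
    refine le_trans ?_ (Finset.single_le_sum hnn (a := x) (by simp [hx]))
    rw [if_pos]
    intro i hi
    by_contra hiJ
    simp only [Finset.mem_filter] at hi
    exact hi.2 (congrFun hxM ⟨i, hiJ⟩)
  · exact Finset.sum_nonneg hnn

/-- The event that everything is erased bounds the error probability from below. -/
theorem pow_le_pmlBEC {k n : ℕ} (hk : 0 < k) (M : Matrix (Fin k) (Fin n) (ZMod 2)) {δ : ℝ}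
    (h0 : 0 ≤ δ) (h1 : δ ≤ 1) : δ ^ n ≤ pmlBEC k n M δ := by
  have h1' := sub_nonneg.2 h1
  have hr : (M.submatrix id
      (Subtype.val : {i : Fin n // i ∉ (Finset.univ : Finset (Fin n))} → Fin n)).rank < k := by
    refine lt_of_le_of_lt (Matrix.rank_le_card_width _) ?_
    simpa using hk
  refine le_trans ?_ (Finset.single_le_sum (f := fun J : Finset (Fin n) =>
    δ ^ J.card * (1 - δ) ^ (n - J.card) *
      (if (M.submatrix id (Subtype.val : {i : Fin n // i ∉ J} → Fin n)).rank < k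
        then (1:ℝ) else 0)) (fun J _ => ?_) (Finset.mem_univ Finset.univ))
  · simp only [hr]
    simp
  · split_ifs <;> positivity

/-- A nonzero vector times a uniformly random matrix is uniformly distributed. -/
theorem card_mul_sum_vecMul {k n : ℕ} (f : (Fin n → ZMod 2) → ℝ) {x : Fin k → ZMod 2}
    (hx : x ≠ 0) :
    (2 : ℝ) ^ n * ∑ M : Matrix (Fin k) (Fin n) (ZMod 2), f (Matrix.vecMul x M) =
      Fintype.card (Matrix (Fin k) (Fin n) (ZMod 2)) * ∑ y, f y := by
  obtain ⟨i, hi⟩ : ∃ i, x i ≠ 0 := by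
    by_contra! h
    exact hx (funext h)
  have hi1 : x i = 1 := by
    generalize x i = a at hi
    revert a
    decide
  have key : ∀ y : Fin n → ZMod 2, ∑ M : Matrix (Fin k) (Fin n) (ZMod 2), f (Matrix.vecMul x M) =
      ∑ M : Matrix (Fin k) (Fin n) (ZMod 2), f (Matrix.vecMul x M + y) := by
    intro y
    rw [← Equiv.sum_comp (Equiv.addRight (Matrix.vecMulVec (Pi.single i 1) y))]
    refine Finset.sum_congr rfl fun M _ => ?_
    rw [Equiv.coe_addRight, Matrix.vecMul_add, Matrix.vecMul_vecMulVec]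
    simp [hi1]
  have h2 : (2 : ℝ) ^ n = (Finset.univ : Finset (Fin n → ZMod 2)).card := by
    simp [ZMod.card]
  rw [h2, ← nsmul_eq_mul, ← Finset.sum_const, Finset.sum_congr rfl fun y _ => key y,
    Finset.sum_comm]
  have : ∀ M : Matrix (Fin k) (Fin n) (ZMod 2), ∑ y, f (Matrix.vecMul x M + y) = ∑ y, f y :=
    fun M => Equiv.sum_comp (Equiv.addLeft (Matrix.vecMul x M)) f
  simp [this]

/-- Every Hamming sphere has total mass one when each vector is weighted by the inverse size of
its sphere. -/
theorem sum_inv_choose_hammingNorm (n : ℕ) :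
    ∑ y : Fin n → ZMod 2, ((n.choose (hammingNorm y) : ℝ))⁻¹ = n + 1 := by
  classical
  have hb : Function.Bijective
      (fun y : Fin n → ZMod 2 => Finset.univ.filter fun i => y i ≠ 0) := by
    have h01 : ∀ a b : ZMod 2, (a ≠ 0 ↔ b ≠ 0) → a = b := by decide
    constructor
    · intro y z hyz
      funext i
      have := Finset.ext_iff.1 hyz i
      simp only [Finset.mem_filter, Finset.mem_univ, true_and] at this
      exact h01 _ _ this
    · intro S
      refine ⟨fun i => if i ∈ S then 1 else 0, ?_⟩
      ext i
      simp
  have := hb.sum_comp (fun S : Finset (Fin n) => ((n.choose S.card : ℝ))⁻¹)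
  simp only [hammingNorm]
  rw [this, ← Finset.powerset_univ,
    Finset.sum_powerset_apply_card (fun m => ((n.choose m : ℝ))⁻¹), Finset.card_univ,
    Fintype.card_fin, Finset.sum_congr rfl (g := fun _ => (1 : ℝ))]
  · simp
  · intro m hm
    have : 0 < n.choose m := Nat.choose_pos (Nat.lt_succ_iff.1 (Finset.mem_range.1 hm))
    rw [nsmul_eq_mul]
    field_simp

/-- Some matrix has a weight distribution no worse than the average over all matrices. -/
theorem exists_matrix_sum_inv_choose_le (k n : ℕ) :
    ∃ M : Matrix (Fin k) (Fin n) (ZMod 2),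
      ∑ x with x ≠ (0 : Fin k → ZMod 2), ((n.choose (hammingNorm (Matrix.vecMul x M)) : ℝ))⁻¹ ≤
        (n + 1) * 2 ^ k / 2 ^ n := by
  obtain ⟨M, -, hM⟩ := Finset.exists_le_of_sum_le
    (s := (Finset.univ : Finset (Matrix (Fin k) (Fin n) (ZMod 2)))) (Finset.univ_nonempty)
    (f := fun M => ∑ x with x ≠ (0 : Fin k → ZMod 2),
      ((n.choose (hammingNorm (Matrix.vecMul x M)) : ℝ))⁻¹)
    (g := fun _ => (n + 1) * 2 ^ k / 2 ^ n) (by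
      rw [Finset.sum_comm]
      have hx : ∀ x ∈ Finset.univ.filter (fun x : Fin k → ZMod 2 => x ≠ 0),
          ∑ M : Matrix (Fin k) (Fin n) (ZMod 2),
            ((n.choose (hammingNorm (Matrix.vecMul x M)) : ℝ))⁻¹ =
          Fintype.card (Matrix (Fin k) (Fin n) (ZMod 2)) * (n + 1) / 2 ^ n := by
        intro x hx
        rw [eq_div_iff (by positivity), mul_comm,
          card_mul_sum_vecMul (fun y => ((n.choose (hammingNorm y) : ℝ))⁻¹)
            (Finset.mem_filter.1 hx).2, sum_inv_choose_hammingNorm]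
      rw [Finset.sum_congr rfl hx, Finset.sum_const, Finset.sum_const, nsmul_eq_mul, nsmul_eq_mul,
        Finset.card_univ]
      have hc : ((Finset.univ.filter (fun x : Fin k → ZMod 2 => x ≠ 0)).card : ℝ) ≤ 2 ^ k := by
        have : (Finset.univ.filter (fun x : Fin k → ZMod 2 => x ≠ 0)).card ≤ 2 ^ k := by
          refine (Finset.card_le_univ _).trans ?_
          simp [ZMod.card]
        exact_mod_cast this
      calc _ ≤ (2 : ℝ) ^ k *
            (Fintype.card (Matrix (Fin k) (Fin n) (ZMod 2)) * (n + 1) / 2 ^ n) := by gcongr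
        _ = _ := by ring)
  exact ⟨M, hM⟩

/-- The entropy bound for binomial coefficients. -/
theorem choose_le_exp_binEnt {n w : ℕ} (hn : 0 < n) (hw : w ≤ n) :
    (n.choose w : ℝ) ≤ Real.exp (n * binEnt (w / n)) := by
  have hn' : (0 : ℝ) < n := by exact_mod_cast hn
  set p : ℝ := w / n with hp
  have hpow : ∀ (q : ℝ) (m : ℕ), 0 ≤ q → (m : ℝ) = n * q →
      q ^ m = Real.exp (-(n * Real.negMulLog q)) := by
    intro q m hq hm
    rcases hq.eq_or_lt with rfl | hq
    · have : m = 0 := by simpa using hm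
      simp [this]
    · rw [Real.negMulLog, ← Real.rpow_natCast, Real.rpow_def_of_pos hq, hm]
      ring_nf
  have hp0 : 0 ≤ p := by positivity
  have hp1 : 0 ≤ 1 - p := sub_nonneg.2 (div_le_one_of_le₀ (by exact_mod_cast hw) hn'.le)
  have hsum : p ^ w * (1 - p) ^ (n - w) * n.choose w ≤ 1 := by
    have h := add_pow p (1 - p) n
    rw [add_sub_cancel, one_pow] at h
    refine le_of_le_of_eq ?_ h.symm
    exact Finset.single_le_sum (f := fun m => p ^ m * (1 - p) ^ (n - m) * (n.choose m : ℝ))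
      (fun m _ => by positivity) (Finset.mem_range.2 (Nat.lt_succ_of_le hw))
  rw [hpow p w hp0 (by rw [hp]; field_simp), hpow (1 - p) (n - w) hp1
    (by rw [hp, Nat.cast_sub hw]; field_simp), ← Real.exp_add] at hsum
  have he : -(n * Real.negMulLog p) + -(n * Real.negMulLog (1 - p)) = -(n * binEnt p) := by
    rw [binEnt]
    ring
  rw [he, Real.exp_neg, inv_mul_le_iff₀ (Real.exp_pos _), mul_one] at hsum
  exact hsum

theorem binEnt_eq_binEntropy : binEnt = Real.binEntropy :=
  Real.binEntropy_eq_negMulLog_add_negMulLog_one_sub'.symm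

/-- The values over which the error exponent is minimised. -/
def exponentValues (ε R : ℝ) : Set ℝ :=
  {y : ℝ | ∃ p : ℝ, 0 ≤ p ∧ p ≤ 1 ∧ Real.log 2 - R ≤ binEnt p ∧
    y = -p * Real.log (1 - ε) + (Real.log 2 - R) - binEnt p}

theorem bddBelow_exponentValues {ε R : ℝ} (hε0 : 0 < ε) (hε1 : ε < 1) :
    BddBelow (exponentValues ε R) := by
  refine ⟨-R, ?_⟩
  rintro y ⟨p, hp0, -, -, rfl⟩
  have h2 : binEnt p ≤ Real.log 2 := by
    rw [binEnt_eq_binEntropy]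
    exact Real.binEntropy_le_log_two
  have hl : Real.log (1 - ε) ≤ 0 := Real.log_nonpos (by linarith) (by linarith)
  nlinarith [mul_nonneg hp0 (neg_nonneg.2 hl)]

/-- Random coding with expurgation: if the code is slightly smaller than `exp (n * R)`, the error
exponent is attained at block length `n`. -/
theorem exists_pmlBEC_le {ε R : ℝ} (hε0 : 0 < ε) (hε1 : ε < 1) {k n : ℕ} (hn : 0 < n)
    (hk : ((n : ℝ) + 1) * 2 ^ k ≤ Real.exp (n * R)) :
    ∃ M : Matrix (Fin k) (Fin n) (ZMod 2),
      pmlBEC k n M (1 - ε) ≤ Real.exp (-(n * sInf (exponentValues ε R))) := by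
  have hn' : (0 : ℝ) < n := by exact_mod_cast hn
  have hδ : 0 < 1 - ε := by linarith
  obtain ⟨M, hM⟩ := exists_matrix_sum_inv_choose_le k n
  have hpow2 : (2 : ℝ) ^ n = Real.exp (n * Real.log 2) := by
    rw [Real.exp_nat_mul, Real.exp_log two_pos]
  have hB : ((n : ℝ) + 1) * 2 ^ k / 2 ^ n ≤ Real.exp (n * (R - Real.log 2)) := by
    rw [mul_sub, Real.exp_sub, ← hpow2]
    gcongr
  have hM' := hM.trans hB
  refine ⟨M, (pmlBEC_le_sum M hδ.le (by linarith)).trans ?_⟩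
  set B := Real.exp (-(n * sInf (exponentValues ε R))) / Real.exp (n * (R - Real.log 2)) with hBdef
  have hterm : ∀ x ∈ Finset.univ.filter (fun x : Fin k → ZMod 2 => x ≠ 0),
      (1 - ε) ^ hammingNorm (Matrix.vecMul x M) ≤
        ((n.choose (hammingNorm (Matrix.vecMul x M)) : ℝ))⁻¹ * B := by
    intro x hx
    have hone := (Finset.single_le_sum (f := fun x =>
      ((n.choose (hammingNorm (Matrix.vecMul x M)) : ℝ))⁻¹) (fun _ _ => by positivity) hx).trans hM'
    have hw : hammingNorm (Matrix.vecMul x M) ≤ n := by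
      simpa using hammingNorm_le_card_fintype (x := Matrix.vecMul x M)
    generalize hammingNorm (Matrix.vecMul x M) = w at hone hw ⊢
    have hC : (0 : ℝ) < n.choose w := by exact_mod_cast Nat.choose_pos hw
    have hCe := choose_le_exp_binEnt hn hw
    have hent : Real.log 2 - R ≤ binEnt (w / n) := by
      have h1 : 1 ≤ Real.exp (n * (R - Real.log 2)) * n.choose w := by
        rwa [inv_le_iff_one_le_mul₀ hC] at hone
      have h2 : 1 ≤ Real.exp (n * (R - Real.log 2)) * Real.exp (n * binEnt (w / n)) :=
        h1.trans (by gcongr)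
      rw [← Real.exp_add, Real.one_le_exp_iff, ← mul_add] at h2
      linarith [nonneg_of_mul_nonneg_right h2 hn']
    have hs : sInf (exponentValues ε R) ≤
        -(w / n) * Real.log (1 - ε) + (Real.log 2 - R) - binEnt (w / n) :=
      csInf_le (bddBelow_exponentValues hε0 hε1)
        ⟨w / n, by positivity, div_le_one_of_le₀ (by exact_mod_cast hw) hn'.le, hent, rfl⟩
    rw [inv_mul_eq_div, le_div_iff₀ hC]
    have hδw : (1 - ε) ^ w = Real.exp (w * Real.log (1 - ε)) := by
      rw [Real.exp_nat_mul, Real.exp_log hδ]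
    calc (1 - ε) ^ w * n.choose w
        ≤ Real.exp (w * Real.log (1 - ε)) * Real.exp (n * binEnt (w / n)) := by
          rw [hδw]
          gcongr
      _ ≤ B := by
          rw [hBdef, ← Real.exp_add, ← Real.exp_sub, Real.exp_le_exp]
          have := mul_le_mul_of_nonneg_left hs hn'.le
          have hwn : (n : ℝ) * (w / n) = w := by field_simp
          have e : (n : ℝ) * (-(w / n) * Real.log (1 - ε) + (Real.log 2 - R) - binEnt (w / n)) =
              -(w * Real.log (1 - ε)) - n * (R - Real.log 2) - n * binEnt (w / n) := by
            rw [← hwn]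
            field_simp
            ring
          linarith
  calc _ ≤ _ := Finset.sum_le_sum hterm
    _ ≤ Real.exp (n * (R - Real.log 2)) * B := by
        rw [← Finset.sum_mul]
        gcongr
    _ = _ := by
        rw [hBdef]
        field_simp

/-- The repetition code only fails when everything is erased. -/
theorem pmlBEC_repetition_le {n : ℕ} {δ : ℝ} (h0 : 0 ≤ δ) (h1 : δ ≤ 1) :
    pmlBEC 1 n (Matrix.of fun _ _ => 1) δ ≤ δ ^ n := by
  refine (pmlBEC_le_sum _ h0 h1).trans ?_
  have hx : Finset.univ.filter (fun x : Fin 1 → ZMod 2 => x ≠ 0) = {fun _ => 1} := by decide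
  rw [hx, Finset.sum_singleton]
  have : Matrix.vecMul (fun _ : Fin 1 => (1 : ZMod 2))
      (Matrix.of fun _ (_ : Fin n) => (1 : ZMod 2)) = fun _ => 1 := by
    ext i
    simp [Matrix.vecMul, dotProduct]
  rw [this]
  simp [hammingNorm]

/-- An exponential upper bound on the error probability bounds the error exponent from below. -/
theorem le_liminf_exponent {δ c : ℝ} (h0 : 0 < δ) (h1 : δ ≤ 1) (kseq : ℕ → ℕ)
    (Mseq : (n : ℕ) → Matrix (Fin (kseq n)) (Fin n) (ZMod 2))
    (hk : ∀ᶠ n in Filter.atTop, 0 < kseq n)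
    (hP : ∀ᶠ n : ℕ in Filter.atTop, pmlBEC (kseq n) n (Mseq n) δ ≤ Real.exp (-(n * c))) :
    c ≤ Filter.liminf
      (fun n : ℕ => -(1 / (n : ℝ)) * Real.log (pmlBEC (kseq n) n (Mseq n) δ)) Filter.atTop := by
  have hlow : ∀ n, 0 < kseq n → n * Real.log δ ≤ Real.log (pmlBEC (kseq n) n (Mseq n) δ) := by
    intro n hkn
    rw [← Real.log_pow]
    exact Real.log_le_log (pow_pos h0 n) (pow_le_pmlBEC hkn _ h0.le h1)
  refine Filter.le_liminf_of_le ?_ ?_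
  · refine Filter.IsBoundedUnder.isCoboundedUnder_ge ⟨-Real.log δ, ?_⟩
    rw [Filter.eventually_map]
    filter_upwards [hk, Filter.eventually_gt_atTop 0] with n hkn hn
    have hn' : (0 : ℝ) < n := by exact_mod_cast hn
    have := hlow n hkn
    rw [neg_mul, neg_le_neg_iff, one_div, inv_mul_eq_div, le_div_iff₀ hn']
    linarith
  · filter_upwards [hk, hP, Filter.eventually_gt_atTop 0] with n hkn hPn hn
    have hn' : (0 : ℝ) < n := by exact_mod_cast hn
    have hpos := (pow_pos h0 n).trans_le (pow_le_pmlBEC hkn (Mseq n) h0.le h1)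
    have := (Real.log_le_iff_le_exp hpos).2 hPn
    rw [neg_mul, le_neg, one_div, inv_mul_eq_div, div_le_iff₀ hn']
    linarith

/-- Code dimensions of asymptotic rate `R` leaving room for a linear factor in the code size. -/
theorem exists_rate_seq {R : ℝ} (hR : 0 < R) :
    ∃ kseq : ℕ → ℕ, (∀ᶠ n in Filter.atTop, 0 < kseq n) ∧
      (∀ᶠ n : ℕ in Filter.atTop, ((n : ℝ) + 1) * 2 ^ kseq n ≤ Real.exp (n * R)) ∧
      Filter.Tendsto (fun n : ℕ => ((kseq n : ℝ) / n) * Real.log 2) Filter.atTop (nhds R) := by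
  have hl2 : 0 < Real.log 2 := Real.log_pos one_lt_two
  have hlog : Filter.Tendsto (fun n : ℕ => (Real.log ((n : ℝ) + 1) + Real.log 2) / n)
      Filter.atTop (nhds 0) := by
    have h1 : Filter.Tendsto (fun n : ℕ => Real.log n / n) Filter.atTop (nhds 0) :=
      (Real.isLittleO_log_id_atTop.tendsto_div_nhds_zero).comp tendsto_natCast_atTop_atTop
    have h2 : Filter.Tendsto (fun n : ℕ => (2 * Real.log 2) / (n : ℝ)) Filter.atTop (nhds 0) :=
      tendsto_const_div_atTop_nhds_zero_nat _
    have h3 := h1.add h2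
    rw [add_zero] at h3
    refine squeeze_zero' ?_ ?_ h3
    · filter_upwards with n
      have : 0 ≤ Real.log ((n : ℝ) + 1) := Real.log_nonneg (by simp)
      positivity
    · filter_upwards [Filter.eventually_ge_atTop 1] with n hn
      have hn' : (1 : ℝ) ≤ n := by exact_mod_cast hn
      rw [← add_div, div_le_div_iff_of_pos_right (by positivity)]
      have : Real.log ((n : ℝ) + 1) ≤ Real.log (n * 2) :=
        Real.log_le_log (by positivity) (by linarith)
      rw [Real.log_mul (by positivity) (by norm_num)] at this
      linarith
  have hlarge : ∀ᶠ n : ℕ in Filter.atTop,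
      Real.log 2 ≤ n * R - Real.log ((n : ℝ) + 1) := by
    filter_upwards [hlog.eventually_le_const hR, Filter.eventually_gt_atTop 0] with n h hn
    have hn' : (0 : ℝ) < n := by exact_mod_cast hn
    rw [div_le_iff₀ hn'] at h
    linarith
  set kseq : ℕ → ℕ := fun n => ⌊(n * R - Real.log ((n : ℝ) + 1)) / Real.log 2⌋₊ with hkdef
  have hup : ∀ᶠ n : ℕ in Filter.atTop,
      Real.log ((n : ℝ) + 1) + kseq n * Real.log 2 ≤ n * R := by
    filter_upwards [hlarge] with n h
    have := Nat.floor_le (a := (n * R - Real.log ((n : ℝ) + 1)) / Real.log 2)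
      (div_nonneg (hl2.le.trans h) hl2.le)
    rw [le_div_iff₀ hl2] at this
    simp only [hkdef]
    linarith
  refine ⟨kseq, ?_, ?_, ?_⟩
  · filter_upwards [hlarge] with n h
    exact Nat.floor_pos.2 ((one_le_div hl2).2 h)
  · filter_upwards [hup] with n h
    rw [← Real.exp_le_exp, Real.exp_add, Real.exp_log (by positivity), Real.exp_nat_mul,
      Real.exp_log two_pos] at h
    exact h
  · have hlo : Filter.Tendsto (fun n : ℕ => R - (Real.log ((n : ℝ) + 1) + Real.log 2) / n)
        Filter.atTop (nhds R) := by
      simpa using hlog.const_sub R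
    refine tendsto_of_tendsto_of_tendsto_of_le_of_le' hlo tendsto_const_nhds ?_ ?_
    · filter_upwards [Filter.eventually_gt_atTop 0] with n hn
      have hn' : (0 : ℝ) < n := by exact_mod_cast hn
      have := Nat.lt_floor_add_one ((n * R - Real.log ((n : ℝ) + 1)) / Real.log 2)
      rw [div_lt_iff₀ hl2] at this
      rw [div_mul_eq_mul_div, sub_le_iff_le_add, ← add_div, le_div_iff₀ hn']
      simp only [hkdef]
      linarith
    · filter_upwards [hup, Filter.eventually_gt_atTop 0] with n h hn
      have hn' : (0 : ℝ) < n := by exact_mod_cast hn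
      have : 0 ≤ Real.log ((n : ℝ) + 1) := Real.log_nonneg (by simp)
      rw [div_mul_eq_mul_div, div_le_iff₀ hn']
      linarith

/-- Csiszár-type linear code construction: there are linear codes of
rate at least `R` whose ML decoding error probability over BEC(1-ε) decays with
exponent at least
`min { -p log(1-ε) + (log 2 - R) - h(p) : p ∈ [0,1], h(p) ≥ log 2 - R }`. -/
theorem exists_matrices_ml_exponent_ge_min (ε R : ℝ) (hε0 : 0 < ε) (hε1 : ε < 1)
    (hR0 : 0 ≤ R) (hR1 : R ≤ Real.log 2) :
    ∃ (kseq : ℕ → ℕ) (Mseq : (n : ℕ) → Matrix (Fin (kseq n)) (Fin n) (ZMod 2)),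
      R ≤ Filter.liminf (fun n : ℕ => ((kseq n : ℝ) / n) * Real.log 2) Filter.atTop ∧
      sInf {y : ℝ | ∃ p : ℝ, 0 ≤ p ∧ p ≤ 1 ∧ Real.log 2 - R ≤ binEnt p ∧
          y = -p * Real.log (1 - ε) + (Real.log 2 - R) - binEnt p} ≤
        Filter.liminf
          (fun n : ℕ => -(1 / (n : ℝ)) *
            Real.log (pmlBEC (kseq n) n (Mseq n) (1 - ε)))
          Filter.atTop := by
  have hδ0 : 0 < 1 - ε := by linarith
  have hδ1 : 1 - ε ≤ 1 := by linarith
  rcases hR0.eq_or_lt with rfl | hR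
  · refine ⟨fun _ => 1, fun _ => Matrix.of fun _ _ => 1, ?_, ?_⟩
    · have h : Filter.Tendsto (fun n : ℕ => (((1 : ℕ) : ℝ) / n) * Real.log 2) Filter.atTop
          (nhds 0) := by
        simpa using (tendsto_const_div_atTop_nhds_zero_nat (1 : ℝ)).mul_const (Real.log 2)
      exact h.liminf_eq.ge
    · refine le_liminf_exponent hδ0 hδ1 _ _ (by simp) (Filter.Eventually.of_forall fun n => ?_)
      refine (pmlBEC_repetition_le hδ0.le hδ1).trans ?_
      have hs : sInf (exponentValues ε 0) ≤ -Real.log (1 - ε) := by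
        have hb : binEnt 2⁻¹ = Real.log 2 := by
          rw [binEnt_eq_binEntropy]
          exact Real.binEntropy_two_inv
        refine (csInf_le (bddBelow_exponentValues hε0 hε1)
          ⟨2⁻¹, by norm_num, by norm_num, by rw [hb]; simp, rfl⟩).trans ?_
        rw [hb]
        linarith [Real.log_nonpos hδ0.le hδ1]
      rw [← Real.exp_log hδ0, ← Real.exp_nat_mul, Real.exp_le_exp, Real.exp_log hδ0]
      have := mul_le_mul_of_nonneg_left hs (Nat.cast_nonneg (α := ℝ) n)
      simp only [exponentValues] at this
      linarith
  · obtain ⟨kseq, hpos, hsize, hrate⟩ := exists_rate_seq hR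
    have hM : ∀ n : ℕ, ∃ M : Matrix (Fin (kseq n)) (Fin n) (ZMod 2),
        0 < n → ((n : ℝ) + 1) * 2 ^ kseq n ≤ Real.exp (n * R) →
          pmlBEC (kseq n) n M (1 - ε) ≤ Real.exp (-(n * sInf (exponentValues ε R))) := by
      intro n
      by_cases h : 0 < n ∧ ((n : ℝ) + 1) * 2 ^ kseq n ≤ Real.exp (n * R)
      · obtain ⟨M, hM⟩ := exists_pmlBEC_le hε0 hε1 h.1 h.2
        exact ⟨M, fun _ _ => hM⟩
      · exact ⟨0, fun h1 h2 => absurd ⟨h1, h2⟩ h⟩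
    choose Mseq hMseq using hM
    refine ⟨kseq, Mseq, hrate.liminf_eq.ge, le_liminf_exponent hδ0 hδ1 kseq Mseq hpos ?_⟩
    filter_upwards [hsize, Filter.eventually_gt_atTop 0] with n h hn
    exact hMseq n hn h
end

section
/- Let 0 < ε < 1, let R ∈ ℝ, and let θ ≥ 1. Then min_{p ∈ [0,1]} [ −p log(1−ε) + θ·( log 2 − R − h(p) ) ] = θ·( log 2 − R − log(1 + (1−ε)^{1/θ}) ), where h(p) = −p log p − (1−p) log(1−p), and the minimum is attained at p = t/(1+t) with t = (1−ε)^{1/θ}. -/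
open scoped BigOperators

theorem negMulLog_le_gibbs {p q : ℝ} (hp : 0 ≤ p) (hq : 0 < q) :
    Real.negMulLog p ≤ -p * Real.log q + (q - p) := by
  rcases hp.eq_or_lt with rfl | hp
  · simpa using hq.le
  · have h := Real.log_le_sub_one_of_pos (div_pos hq hp)
    rw [Real.log_div hq.ne' hp.ne'] at h
    have h' := mul_le_mul_of_nonneg_left h hp.le
    have hpq : p * (q / p - 1) = q - p := by field_simp
    rw [hpq] at h'
    rw [Real.negMulLog]
    linarith

theorem log_div_one_add {t : ℝ} (ht : 0 < t) :
    Real.log (t / (1 + t)) = Real.log t - Real.log (1 + t) :=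
  Real.log_div ht.ne' (by positivity)

theorem one_sub_div_one_add {t : ℝ} (ht : 0 < t) : 1 - t / (1 + t) = (1 + t)⁻¹ := by
  field_simp
  ring

theorem mul_log_add_binEnt_le {p t : ℝ} (hp : p ∈ Set.Icc (0 : ℝ) 1) (ht : 0 < t) :
    p * Real.log t + binEnt p ≤ Real.log (1 + t) := by
  have h₁ := negMulLog_le_gibbs hp.1 (q := t / (1 + t)) (by positivity)
  have h₂ := negMulLog_le_gibbs (sub_nonneg.2 hp.2) (q := (1 + t)⁻¹) (by positivity)
  rw [log_div_one_add ht] at h₁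
  rw [Real.log_inv, ← one_sub_div_one_add ht] at h₂
  rw [binEnt]
  linarith

theorem mul_log_add_binEnt_div_one_add {t : ℝ} (ht : 0 < t) :
    t / (1 + t) * Real.log t + binEnt (t / (1 + t)) = Real.log (1 + t) := by
  rw [binEnt, Real.negMulLog, Real.negMulLog, log_div_one_add ht,
    congrArg Real.log (one_sub_div_one_add ht), Real.log_inv]
  ring

/-- for `θ ≥ 1` and `t = (1-ε)^{1/θ}`,
`min_{p ∈ [0,1]} [ -p log(1-ε) + θ (log 2 - R - h(p)) ] = θ (log 2 - R - log(1+t))`,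
attained at `p = t/(1+t)`. -/
theorem min_linear_entropy_objective (ε R θ : ℝ) (hε0 : 0 < ε) (hε1 : ε < 1)
    (hθ : 1 ≤ θ) :
    (∀ p ∈ Set.Icc (0:ℝ) 1,
        θ * (Real.log 2 - R - Real.log (1 + (1 - ε) ^ (1 / θ))) ≤
          -p * Real.log (1 - ε) + θ * (Real.log 2 - R - binEnt p)) ∧
    -((1 - ε) ^ (1 / θ) / (1 + (1 - ε) ^ (1 / θ))) * Real.log (1 - ε) +
        θ * (Real.log 2 - R - binEnt ((1 - ε) ^ (1 / θ) / (1 + (1 - ε) ^ (1 / θ)))) =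
      θ * (Real.log 2 - R - Real.log (1 + (1 - ε) ^ (1 / θ))) := by
  have ht : 0 < (1 - ε) ^ (1 / θ) := Real.rpow_pos_of_pos (by linarith) _
  have hlog : Real.log (1 - ε) = θ * Real.log ((1 - ε) ^ (1 / θ)) := by
    rw [Real.log_rpow (by linarith)]
    field_simp
  generalize (1 - ε) ^ (1 / θ) = t at ht hlog ⊢
  rw [hlog]
  refine ⟨fun p hp => ?_, ?_⟩
  · have h := mul_le_mul_of_nonneg_left (mul_log_add_binEnt_le hp ht) (zero_le_one.trans hθ)
    linarith
  · linear_combination -θ * mul_log_add_binEnt_div_one_add ht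
end

section
/- Let 0 < ε < 1 and 0 ≤ R ≤ log 2. Then min{ −p log(1−ε) + (log 2 − R) − h(p) : p ∈ [0,1], h(p) ≥ log 2 − R } = sup_{θ ≥ 1} θ·( log 2 − R − log(1 + (1−ε)^{1/θ}) ), where h(p) = −p log p − (1−p) log(1−p). That is, the constrained minimization defining the exponent of the code construction over BEC(1−ε) equals the expurgation exponent E_x(R, 1−ε). -/
open scoped BigOperators

/-- The weight that the Gibbs distribution `(1, exp (-s)) / (1 + exp (-s))` puts on the second
letter; it maximizes `binEnt p - p * s`. -/
noncomputable def gibbsWeight (s : ℝ) : ℝ := Real.exp (-s) / (1 + Real.exp (-s))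

lemma gibbsWeight_pos (s : ℝ) : 0 < gibbsWeight s := by
  unfold gibbsWeight; positivity

lemma one_sub_gibbsWeight (s : ℝ) : 1 - gibbsWeight s = 1 / (1 + Real.exp (-s)) := by
  have : 0 < Real.exp (-s) := Real.exp_pos _
  unfold gibbsWeight
  field_simp
  ring

lemma gibbsWeight_lt_one (s : ℝ) : gibbsWeight s < 1 := by
  have h : 0 < 1 - gibbsWeight s := by
    rw [one_sub_gibbsWeight]; positivity
  linarith

lemma gibbsWeight_zero : gibbsWeight 0 = 1 / 2 := by
  norm_num [gibbsWeight]

lemma continuous_gibbsWeight : Continuous gibbsWeight := by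
  unfold gibbsWeight
  exact (by fun_prop : Continuous fun s : ℝ => Real.exp (-s)).div (by fun_prop)
    fun s => by positivity

lemma log_gibbsWeight (s : ℝ) :
    Real.log (gibbsWeight s) = -s - Real.log (1 + Real.exp (-s)) := by
  unfold gibbsWeight
  rw [Real.log_div (by positivity) (by positivity), Real.log_exp]

lemma log_one_sub_gibbsWeight (s : ℝ) :
    Real.log (1 - gibbsWeight s) = -Real.log (1 + Real.exp (-s)) := by
  rw [one_sub_gibbsWeight, one_div, Real.log_inv]

lemma negMulLog_add_mul_log_le {p q : ℝ} (hp : 0 ≤ p) (hq : 0 < q) :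
    Real.negMulLog p + p * Real.log q ≤ q - p := by
  rcases hp.eq_or_lt with rfl | hp
  · simpa using hq.le
  · have h := mul_le_mul_of_nonneg_left (Real.log_le_sub_one_of_pos (div_pos hq hp)) hp.le
    rw [Real.log_div hq.ne' hp.ne', mul_sub, mul_sub, mul_div_cancel₀ _ hp.ne'] at h
    unfold Real.negMulLog
    linarith

/-- Gibbs' variational inequality on a two-letter alphabet. -/
lemma binEnt_le_mul_add_log {p : ℝ} (hp0 : 0 ≤ p) (hp1 : p ≤ 1) (s : ℝ) :
    binEnt p ≤ p * s + Real.log (1 + Real.exp (-s)) := by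
  have h₁ := negMulLog_add_mul_log_le hp0 (gibbsWeight_pos s)
  have h₂ := negMulLog_add_mul_log_le (sub_nonneg.2 hp1) (sub_pos.2 (gibbsWeight_lt_one s))
  rw [log_gibbsWeight] at h₁
  rw [log_one_sub_gibbsWeight] at h₂
  unfold binEnt
  linarith

lemma binEnt_gibbsWeight (s : ℝ) :
    binEnt (gibbsWeight s) = gibbsWeight s * s + Real.log (1 + Real.exp (-s)) := by
  unfold binEnt Real.negMulLog
  rw [log_gibbsWeight, log_one_sub_gibbsWeight]
  ring

lemma continuous_binEnt : Continuous binEnt := by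
  unfold binEnt
  exact Real.continuous_negMulLog.add (Real.continuous_negMulLog.comp (by fun_prop))

lemma binEnt_half : binEnt (1 / 2) = Real.log 2 := by
  have h := binEnt_gibbsWeight 0
  norm_num [gibbsWeight_zero] at h ⊢
  exact h

lemma binEnt_le_log_two {p : ℝ} (hp0 : 0 ≤ p) (hp1 : p ≤ 1) : binEnt p ≤ Real.log 2 := by
  have h := binEnt_le_mul_add_log hp0 hp1 0
  norm_num at h
  exact h

/-- Lagrangian duality: the minimum of `p * a + c - binEnt p` over `c ≤ binEnt p` is the supremum
of the dual function, in which the multiplier `θ` ranges over `[1, ∞)`. -/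
lemma sInf_primal_eq_sSup_dual {a c : ℝ} (hc : c ≤ Real.log 2) :
    sInf {y : ℝ | ∃ p : ℝ, 0 ≤ p ∧ p ≤ 1 ∧ c ≤ binEnt p ∧ y = p * a + c - binEnt p} =
      sSup {y : ℝ | ∃ θ : ℝ, 1 ≤ θ ∧ y = θ * (c - Real.log (1 + Real.exp (-(a / θ))))} := by
  set P := {y : ℝ | ∃ p : ℝ, 0 ≤ p ∧ p ≤ 1 ∧ c ≤ binEnt p ∧ y = p * a + c - binEnt p}
  set D := {y : ℝ | ∃ θ : ℝ, 1 ≤ θ ∧ y = θ * (c - Real.log (1 + Real.exp (-(a / θ))))}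
  have weak : ∀ x ∈ P, ∀ y ∈ D, y ≤ x := by
    rintro _ ⟨p, hp0, hp1, hcp, rfl⟩ _ ⟨θ, hθ, rfl⟩
    have hθ0 : θ ≠ 0 := by positivity
    have h := mul_le_mul_of_nonneg_left (binEnt_le_mul_add_log hp0 hp1 (a / θ))
      (zero_le_one.trans hθ)
    have e : θ * (p * (a / θ)) = p * a := by field_simp
    rw [mul_add, e] at h
    nlinarith [mul_nonneg (sub_nonneg.2 hθ) (sub_nonneg.2 hcp)]
  have hhalf : 1 / 2 * a + c - binEnt (1 / 2) ∈ P :=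
    ⟨1 / 2, by norm_num, by norm_num, by rwa [binEnt_half], rfl⟩
  have hone : 1 * (c - Real.log (1 + Real.exp (-(a / 1)))) ∈ D := ⟨1, le_rfl, rfl⟩
  have bddP : BddBelow P := ⟨_, fun x hx => weak x hx _ hone⟩
  have bddD : BddAbove D := ⟨_, fun y hy => weak _ hhalf y hy⟩
  have dual_eq : ∀ t : ℝ, 0 < t → t ≤ 1 →
      gibbsWeight (a * t) * a + 1 / t * (c - binEnt (gibbsWeight (a * t))) ∈ D := by
    intro t ht0 ht1
    refine ⟨1 / t, (one_le_div ht0).2 ht1, ?_⟩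
    have e : a / (1 / t) = a * t := by field_simp
    rw [e, binEnt_gibbsWeight]
    field_simp
    ring
  have mem_P : ∀ s : ℝ, c ≤ binEnt (gibbsWeight s) →
      gibbsWeight s * a + c - binEnt (gibbsWeight s) ∈ P := fun s hs =>
    ⟨_, (gibbsWeight_pos s).le, (gibbsWeight_lt_one s).le, hs, rfl⟩
  apply le_antisymm
  · rcases le_or_gt c (binEnt (gibbsWeight (a * 1))) with hcase | hcase
    · refine (csInf_le bddP (mem_P _ hcase)).trans (le_csSup bddD ?_)
      convert dual_eq 1 one_pos le_rfl using 1
      ring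
    · have hcont : Continuous fun t : ℝ => gibbsWeight (a * t) :=
        continuous_gibbsWeight.comp (by fun_prop)
      obtain ⟨t, ⟨ht0, ht1⟩, ht⟩ := intermediate_value_Icc' (zero_le_one (α := ℝ))
        (continuous_binEnt.comp hcont).continuousOn
        (show c ∈ Set.Icc _ _ from
          ⟨hcase.le, by simpa [gibbsWeight_zero, ← binEnt_half] using hc⟩)
      simp only [Function.comp_apply] at ht
      have hle := csInf_le bddP (mem_P _ ht.ge)
      rw [ht, add_sub_cancel_right] at hle
      rcases ht0.eq_or_lt with rfl | ht0
      · have hc2 : c = Real.log 2 := by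
          rw [← ht, mul_zero, gibbsWeight_zero, binEnt_half]
        refine hle.trans (le_of_tendsto
          (((hcont.mul_const a).tendsto 0).mono_left (nhdsWithin_le_nhds (s := Set.Ioi 0))) ?_)
        filter_upwards [Ioc_mem_nhdsGT (zero_lt_one (α := ℝ))] with t ht
        refine le_trans (le_add_of_nonneg_right ?_) (le_csSup bddD (dual_eq t ht.1 ht.2))
        have := binEnt_le_log_two (gibbsWeight_pos (a * t)).le (gibbsWeight_lt_one (a * t)).le
        exact mul_nonneg (one_div_nonneg.2 ht.1.le) (by linarith)
      · refine hle.trans (le_csSup bddD ?_)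
        simpa [ht] using dual_eq t ht0 ht1
  · exact csSup_le ⟨_, hone⟩ fun y hy => le_csInf ⟨_, hhalf⟩ fun x hx => weak x hx y hy

/-- the constrained minimization defining the exponent of the code
construction over BEC(1-ε) equals the expurgation exponent
`E_x(R, 1-ε) = sup_{θ ≥ 1} θ (log 2 - R - log(1 + (1-ε)^{1/θ}))`. -/
theorem min_form_eq_expurgation_exponent (ε R : ℝ) (hε0 : 0 < ε) (hε1 : ε < 1)
    (hR0 : 0 ≤ R) (hR1 : R ≤ Real.log 2) :
    sInf {y : ℝ | ∃ p : ℝ, 0 ≤ p ∧ p ≤ 1 ∧ Real.log 2 - R ≤ binEnt p ∧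
        y = -p * Real.log (1 - ε) + (Real.log 2 - R) - binEnt p} =
      sSup {y : ℝ | ∃ θ : ℝ, 1 ≤ θ ∧
        y = θ * (Real.log 2 - R - Real.log (1 + (1 - ε) ^ (1 / θ)))} := by
  have hpow : ∀ θ : ℝ, (1 - ε) ^ (1 / θ) = Real.exp (-(-Real.log (1 - ε) / θ)) := fun θ => by
    rw [Real.rpow_def_of_pos (by linarith)]
    ring_nf
  simp only [hpow, neg_mul_comm]
  exact sInf_primal_eq_sSup_dual (by linarith)
end

section
/- Let 0 < ε < 1/2, let X^n be uniform on F_2^n, let Z^n be the output of n independent uses of the binary symmetric channel BSC(ε) with input X^n, and let Z̄^n be the output of n independent uses of the binary erasure channel BEC(4ε(1−ε)) with input X^n, where Z^n and Z̄^n are conditionally independent given X^n. Then for every finite set S and every function f : F_2^n → S, setting S_n = f(X^n), the mutual informations satisfy I(S_n; Z^n) ≤ I(S_n; Z̄^n). -/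
open scoped BigOperators

/-- Joint pmf of the uniform input `x` on `F_2^n` and the output `z` of `n` independent
uses of a binary symmetric channel with crossover probability `ε`. -/
noncomputable def bscJointN (n : ℕ) (ε : ℝ) (x z : Fin n → ZMod 2) : ℝ :=
  (1 / 2 ^ n) * ∏ i, (if z i = x i then 1 - ε else ε)

/-- Joint pmf of the uniform input `x` on `F_2^n` and the output `z` of `n` independent
uses of a binary erasure channel with erasure probability `δ`
(`none` is the erasure symbol `?`). -/
noncomputable def becJointN (n : ℕ) (δ : ℝ) (x : Fin n → ZMod 2)
    (z : Fin n → Option (ZMod 2)) : ℝ :=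
  (1 / 2 ^ n) * ∏ i, (if z i = some (x i) then 1 - δ else if z i = none then δ else 0)

/-- Mutual information `I(f(X); Z)` in nats, for a joint pmf `p` of `X` and `Z` and
a function `f` of `X`. -/
noncomputable def miFun {XA ZA S : Type*} [Fintype XA] [Fintype ZA] [Fintype S]
    [DecidableEq S] (p : XA → ZA → ℝ) (f : XA → S) : ℝ :=
  ∑ s : S, ∑ z : ZA,
    (∑ x ∈ Finset.univ.filter fun x => f x = s, p x z) *
      Real.log ((∑ x ∈ Finset.univ.filter fun x => f x = s, p x z) /
        ((∑ z' : ZA, ∑ x ∈ Finset.univ.filter fun x => f x = s, p x z') *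
          (∑ s' : S, ∑ x ∈ Finset.univ.filter fun x => f x = s', p x z)))

lemma sum_zmod_two (F : ZMod 2 → ℝ) : ∑ x, F x = F 0 + F 1 :=
  Fin.sum_univ_two F

section LessNoisy

variable {S : Type*} [Fintype S]

/-- Scaling law of `t ↦ t * log t`. -/
lemma mul_log_mul_left {c : ℝ} (hc : c ≠ 0) (t : ℝ) :
    (c * t) * Real.log (c * t) = c * t * Real.log c + c * (t * Real.log t) := by
  rcases eq_or_ne t 0 with rfl | ht
  · simp
  · rw [Real.log_mul hc ht]; ring

/-- The negative binary entropy of a `±1`-valued variable with mean `x`, up to a constant. -/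
noncomputable def biasEntropy (x : ℝ) : ℝ :=
  ((1 + x) * Real.log (1 + x) + (1 - x) * Real.log (1 - x)) / 2

lemma continuous_biasEntropy : Continuous biasEntropy := by
  have h₁ : Continuous fun x : ℝ => (1 + x) * Real.log (1 + x) :=
    Real.continuous_mul_log.comp (continuous_const.add continuous_id)
  have h₂ : Continuous fun x : ℝ => (1 - x) * Real.log (1 - x) :=
    Real.continuous_mul_log.comp (continuous_const.sub continuous_id)
  exact (h₁.add h₂).div_const 2

lemma hasDerivAt_biasEntropy {x : ℝ} (h₁ : -1 < x) (h₂ : x < 1) :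
    HasDerivAt biasEntropy ((Real.log (1 + x) - Real.log (1 - x)) / 2) x := by
  have hp : HasDerivAt (fun y : ℝ => 1 + y) 1 x := (hasDerivAt_id x).const_add 1
  have hm : HasDerivAt (fun y : ℝ => 1 - y) (-1) x := (hasDerivAt_id x).const_sub 1
  have h := ((hp.mul (hp.log (by linarith))).add (hm.mul (hm.log (by linarith)))).div_const 2
  refine h.congr_deriv ?_
  have : 1 + x ≠ 0 := by linarith
  have : 1 - x ≠ 0 := by linarith
  field_simp
  ring

lemma hasDerivAt_log_sub_log {x : ℝ} (h₁ : -1 < x) (h₂ : x < 1) :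
    HasDerivAt (fun y : ℝ => (Real.log (1 + y) - Real.log (1 - y)) / 2) (1 / (1 - x ^ 2)) x := by
  have hp : HasDerivAt (fun y : ℝ => 1 + y) 1 x := (hasDerivAt_id x).const_add 1
  have hm : HasDerivAt (fun y : ℝ => 1 - y) (-1) x := (hasDerivAt_id x).const_sub 1
  have h := ((hp.log (by linarith)).sub (hm.log (by linarith))).div_const 2
  refine h.congr_deriv ?_
  have : 1 + x ≠ 0 := by linarith
  have : 1 - x ≠ 0 := by linarith
  have : 1 - x ^ 2 ≠ 0 := by nlinarith
  field_simp
  ring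

lemma convexOn_biasEntropy_sub {l : ℝ} (h₀ : 0 ≤ l) (h₁ : l ≤ 1) :
    ConvexOn ℝ (Set.Icc (-1) 1) fun x => l ^ 2 * biasEntropy x - biasEntropy (l * x) := by
  have hmul : ∀ x, x ∈ Set.Ioo (-1 : ℝ) 1 → -1 < l * x ∧ l * x < 1 := by
    rintro x ⟨hx₁, hx₂⟩
    constructor <;> nlinarith
  refine convexOn_of_hasDerivWithinAt2_nonneg (convex_Icc _ _)
    (f' := fun x => l ^ 2 * ((Real.log (1 + x) - Real.log (1 - x)) / 2) -
      (Real.log (1 + l * x) - Real.log (1 - l * x)) / 2 * l)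
    (f'' := fun x => l ^ 2 * (1 / (1 - x ^ 2)) - 1 / (1 - (l * x) ^ 2) * l * l) ?_ ?_ ?_ ?_
  · exact ((continuous_biasEntropy.const_mul _).sub
      (continuous_biasEntropy.comp (continuous_const.mul continuous_id))).continuousOn
  all_goals rw [interior_Icc]; intro x hx; obtain ⟨hl₁, hl₂⟩ := hmul x hx
  · have hl : HasDerivAt (fun y : ℝ => l * y) l x := by
      simpa using (hasDerivAt_id x).const_mul l
    exact (((hasDerivAt_biasEntropy hx.1 hx.2).const_mul _).sub
      ((hasDerivAt_biasEntropy hl₁ hl₂).comp x hl)).hasDerivWithinAt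
  · have hl : HasDerivAt (fun y : ℝ => l * y) l x := by
      simpa using (hasDerivAt_id x).const_mul l
    exact (((hasDerivAt_log_sub_log hx.1 hx.2).const_mul _).sub
      (((hasDerivAt_log_sub_log hl₁ hl₂).comp x hl).mul_const l)).hasDerivWithinAt
  · have hpos : 0 < 1 - x ^ 2 := by nlinarith [hx.1, hx.2]
    have hle : 1 - x ^ 2 ≤ 1 - (l * x) ^ 2 := by
      have : l ^ 2 * x ^ 2 ≤ 1 * x ^ 2 :=
        mul_le_mul_of_nonneg_right (by nlinarith) (sq_nonneg x)
      nlinarith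
    have := mul_le_mul_of_nonneg_left (one_div_le_one_div_of_le hpos hle) (sq_nonneg l)
    linarith

/-- Per-symbol difference of the erasure-channel and symmetric-channel contributions, for
masses `a`, `b` on the two input letters and a symmetric channel of correlation `l`. -/
noncomputable def letterGap (l a b : ℝ) : ℝ :=
  l ^ 2 * (a * Real.log a + b * Real.log b) + (1 - l ^ 2) * ((a + b) * Real.log (a + b)) -
    (((1 + l) / 2 * a + (1 - l) / 2 * b) * Real.log ((1 + l) / 2 * a + (1 - l) / 2 * b) +
      ((1 - l) / 2 * a + (1 + l) / 2 * b) * Real.log ((1 - l) / 2 * a + (1 + l) / 2 * b))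

lemma letterGap_eq (l : ℝ) {m : ℝ} (hm : 0 < m) (x : ℝ) :
    letterGap l (m / 2 * (1 + x)) (m / 2 * (1 - x)) =
      m * (l ^ 2 * biasEntropy x - biasEntropy (l * x)) + m * ((1 - l ^ 2) * Real.log 2) := by
  have hm' : m / 2 ≠ 0 := by positivity
  have e₁ : m / 2 * (1 + x) + m / 2 * (1 - x) = m / 2 * 2 := by ring
  have e₂ : (1 + l) / 2 * (m / 2 * (1 + x)) + (1 - l) / 2 * (m / 2 * (1 - x)) =
    m / 2 * (1 + l * x) := by ring
  have e₃ : (1 - l) / 2 * (m / 2 * (1 + x)) + (1 + l) / 2 * (m / 2 * (1 - x)) =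
    m / 2 * (1 - l * x) := by ring
  unfold letterGap biasEntropy
  rw [e₁, e₂, e₃]
  simp only [mul_log_mul_left hm']
  ring

lemma exists_bias {a b : ℝ} (ha : 0 ≤ a) (hb : 0 ≤ b) :
    ∃ x ∈ Set.Icc (-1 : ℝ) 1, a = (a + b) / 2 * (1 + x) ∧ b = (a + b) / 2 * (1 - x) := by
  rcases eq_or_lt_of_le (add_nonneg ha hb) with h | h
  · exact ⟨0, by simp, by linarith, by linarith⟩
  · refine ⟨(a - b) / (a + b), ⟨?_, ?_⟩, ?_, ?_⟩
    · rw [le_div_iff₀ h]; linarith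
    · rw [div_le_iff₀ h]; linarith
    · field_simp; ring
    · field_simp; ring

lemma letterGap_sum_le {l : ℝ} (h₀ : 0 ≤ l) (h₁ : l ≤ 1) {a b : S → ℝ}
    (ha : ∀ s, 0 ≤ a s) (hb : ∀ s, 0 ≤ b s) :
    letterGap l (∑ s, a s) (∑ s, b s) ≤ ∑ s, letterGap l (a s) (b s) := by
  choose x hx hxa hxb using fun s => exists_bias (ha s) (hb s)
  obtain ⟨M, hM⟩ : ∃ M, M = ∑ s, (a s + b s) := ⟨_, rfl⟩
  have hM_nonneg : 0 ≤ M := hM ▸ Finset.sum_nonneg fun s _ => add_nonneg (ha s) (hb s)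
  rcases eq_or_lt_of_le hM_nonneg with hM₀ | hM₀
  · have hz := (Finset.sum_eq_zero_iff_of_nonneg
      fun s _ => add_nonneg (ha s) (hb s)).1 (hM.symm.trans hM₀.symm)
    have ha' : ∀ s, a s = 0 := fun s => by
      linarith [ha s, hb s, hz s (Finset.mem_univ s)]
    have hb' : ∀ s, b s = 0 := fun s => by
      linarith [ha s, hb s, hz s (Finset.mem_univ s)]
    simp [ha', hb', letterGap]
  · have hgap : ∀ s, letterGap l (a s) (b s) =
        (a s + b s) * (l ^ 2 * biasEntropy (x s) - biasEntropy (l * x s)) +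
          (a s + b s) * ((1 - l ^ 2) * Real.log 2) := by
      intro s
      rcases eq_or_lt_of_le (add_nonneg (ha s) (hb s)) with h | h
      · have ha' : a s = 0 := by linarith [ha s, hb s]
        have hb' : b s = 0 := by linarith [ha s, hb s]
        simp [ha', hb', letterGap]
      · rw [← letterGap_eq l h, ← hxa, ← hxb]
    set y := ∑ s, ((a s + b s) / M) • x s with hy
    have hMy : M * y = ∑ s, (a s + b s) * x s := by
      rw [hy, Finset.mul_sum]
      refine Finset.sum_congr rfl fun s _ => ?_
      rw [smul_eq_mul]; field_simp
    have hA : ∑ s, a s = M / 2 * (1 + y) := by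
      have : M / 2 * (1 + y) = (M + M * y) / 2 := by ring
      rw [this, hMy, hM, ← Finset.sum_add_distrib, Finset.sum_div]
      exact Finset.sum_congr rfl fun s _ => by linarith [hxa s]
    have hB : ∑ s, b s = M / 2 * (1 - y) := by
      have : M / 2 * (1 - y) = (M - M * y) / 2 := by ring
      rw [this, hMy, hM, ← Finset.sum_sub_distrib, Finset.sum_div]
      exact Finset.sum_congr rfl fun s _ => by linarith [hxb s]
    have hJ := (convexOn_biasEntropy_sub h₀ h₁).map_sum_le (t := Finset.univ)
      (w := fun s => (a s + b s) / M) (p := x)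
      (fun s _ => div_nonneg (add_nonneg (ha s) (hb s)) hM₀.le)
      (by rw [← Finset.sum_div, ← hM, div_self hM₀.ne']) (fun s _ => hx s)
    have hJ' := mul_le_mul_of_nonneg_left hJ hM₀.le
    rw [hA, hB, letterGap_eq l hM₀]
    rw [Finset.sum_congr rfl fun s _ => hgap s, Finset.sum_add_distrib, ← Finset.sum_mul, ← hM,
      add_le_add_iff_right]
    refine hJ'.trans_eq ?_
    rw [Finset.mul_sum]
    refine Finset.sum_congr rfl fun s _ => ?_
    rw [smul_eq_mul]; field_simp

/-- The total mass times the negative entropy of a finite nonnegative vector. -/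
noncomputable def negEntropy (v : S → ℝ) : ℝ :=
  ∑ s, v s * Real.log (v s) - (∑ s, v s) * Real.log (∑ s, v s)

lemma negEntropy_mul (c : ℝ) (v : S → ℝ) :
    negEntropy (fun s => c * v s) = c * negEntropy v := by
  rcases eq_or_ne c 0 with rfl | hc
  · simp [negEntropy]
  · unfold negEntropy
    rw [← Finset.mul_sum, mul_log_mul_left hc]
    simp only [mul_log_mul_left hc, Finset.sum_add_distrib, ← Finset.mul_sum, ← Finset.sum_mul]
    ring

/-- The symmetric channel is dominated by the erasure channel, for a single letter. -/
lemma negEntropy_bsc_le_bec {l : ℝ} (h₀ : 0 ≤ l) (h₁ : l ≤ 1) {a b : S → ℝ}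
    (ha : ∀ s, 0 ≤ a s) (hb : ∀ s, 0 ≤ b s) :
    negEntropy (fun s => (1 + l) / 2 * a s + (1 - l) / 2 * b s) +
        negEntropy (fun s => (1 - l) / 2 * a s + (1 + l) / 2 * b s) ≤
      l ^ 2 * (negEntropy a + negEntropy b) + (1 - l ^ 2) * negEntropy (fun s => a s + b s) := by
  have h := letterGap_sum_le h₀ h₁ ha hb
  simp only [letterGap, Finset.sum_sub_distrib, Finset.sum_add_distrib, ← Finset.mul_sum] at h
  simp only [negEntropy, Finset.sum_add_distrib, ← Finset.mul_sum]
  linarith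

lemma sum_fin_succ_pi {W : Type*} [Fintype W] {n : ℕ} (F : (Fin (n + 1) → W) → ℝ) :
    ∑ w, F w = ∑ w₀, ∑ w, F (Fin.cons w₀ w) := by
  rw [← (Fin.consEquiv fun _ => W).sum_comp, Fintype.sum_prod_type]
  rfl

/-- Tensorization: domination of channels in the sense of `negEntropy` passes from one use
to `n` independent uses. -/
lemma sum_negEntropy_pi_le {X Y Z : Type*} [Fintype X] [Fintype Y] [Fintype Z]
    {B : X → Y → ℝ} {E : X → Z → ℝ} (hB : ∀ x y, 0 ≤ B x y) (hE : ∀ x z, 0 ≤ E x z)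
    (h : ∀ v : X → S → ℝ, (∀ x s, 0 ≤ v x s) →
      ∑ y, negEntropy (fun s => ∑ x, v x s * B x y) ≤
        ∑ z, negEntropy (fun s => ∑ x, v x s * E x z))
    (n : ℕ) (q : (Fin n → X) → S → ℝ) (hq : ∀ x s, 0 ≤ q x s) :
    ∑ y : Fin n → Y, negEntropy (fun s => ∑ x, q x s * ∏ i, B (x i) (y i)) ≤
      ∑ z : Fin n → Z, negEntropy (fun s => ∑ x, q x s * ∏ i, E (x i) (z i)) := by
  induction n with
  | zero => simp
  | succ n ih =>
    have hq' : ∀ y₀ x s, 0 ≤ ∑ x₀, q (Fin.cons x₀ x) s * B x₀ y₀ := fun y₀ x s =>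
      Finset.sum_nonneg fun x₀ _ => mul_nonneg (hq _ s) (hB x₀ y₀)
    have hv : ∀ (z : Fin n → Z) x₀ s,
        0 ≤ ∑ x : Fin n → X, q (Fin.cons x₀ x) s * ∏ i, E (x i) (z i) := fun z x₀ s =>
      Finset.sum_nonneg fun x _ => mul_nonneg (hq _ s) (Finset.prod_nonneg fun i _ => hE _ _)
    simp only [sum_fin_succ_pi, Fin.prod_univ_succ, Fin.cons_zero, Fin.cons_succ]
    calc
      _ = ∑ y₀, ∑ y : Fin n → Y, negEntropy fun s =>
            ∑ x, (∑ x₀, q (Fin.cons x₀ x) s * B x₀ y₀) * ∏ i, B (x i) (y i) := by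
        simp only [Finset.sum_mul, mul_assoc]
        refine Finset.sum_congr rfl fun y₀ _ => Finset.sum_congr rfl fun y _ => ?_
        congr 1
        funext s
        exact Finset.sum_comm
      _ ≤ ∑ y₀, ∑ z : Fin n → Z, negEntropy fun s =>
            ∑ x, (∑ x₀, q (Fin.cons x₀ x) s * B x₀ y₀) * ∏ i, E (x i) (z i) :=
        Finset.sum_le_sum fun y₀ _ => ih _ (hq' y₀)
      _ = ∑ z : Fin n → Z, ∑ y₀, negEntropy fun s =>
            ∑ x₀, (∑ x : Fin n → X, q (Fin.cons x₀ x) s * ∏ i, E (x i) (z i)) * B x₀ y₀ := by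
        rw [Finset.sum_comm]
        simp only [Finset.sum_mul]
        refine Finset.sum_congr rfl fun z _ => Finset.sum_congr rfl fun y₀ _ => ?_
        congr 1
        funext s
        rw [Finset.sum_comm]
        simp only [mul_right_comm]
      _ ≤ ∑ z : Fin n → Z, ∑ z₀, negEntropy fun s =>
            ∑ x₀, (∑ x : Fin n → X, q (Fin.cons x₀ x) s * ∏ i, E (x i) (z i)) * E x₀ z₀ :=
        Finset.sum_le_sum fun z _ => h _ (hv z)
      _ = _ := by
        rw [Finset.sum_comm]
        simp only [Finset.sum_mul]
        refine Finset.sum_congr rfl fun z₀ _ => Finset.sum_congr rfl fun z _ => ?_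
        congr 1
        funext s
        refine Finset.sum_congr rfl fun x₀ _ => Finset.sum_congr rfl fun x _ => ?_
        ring

lemma miFun_eq [DecidableEq S] {X Z : Type*} [Fintype X] [Fintype Z] {p : X → Z → ℝ}
    (hp : ∀ x z, 0 ≤ p x z) (f : X → S) :
    miFun p f = ∑ z, negEntropy (fun s => ∑ x with f x = s, p x z) -
      ∑ s, (∑ x with f x = s, ∑ z, p x z) * Real.log (∑ x with f x = s, ∑ z, p x z) := by
  have hterm : ∀ s z, (∑ x with f x = s, p x z) *
      Real.log ((∑ x with f x = s, p x z) /
        ((∑ z', ∑ x with f x = s, p x z') * (∑ s', ∑ x with f x = s', p x z))) =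
      (∑ x with f x = s, p x z) * Real.log (∑ x with f x = s, p x z) -
      (∑ x with f x = s, p x z) * Real.log (∑ z', ∑ x with f x = s, p x z') -
      (∑ x with f x = s, p x z) * Real.log (∑ s', ∑ x with f x = s', p x z) := by
    intro s z
    have hnn : ∀ s z, 0 ≤ ∑ x with f x = s, p x z := fun s z =>
      Finset.sum_nonneg fun x _ => hp x z
    rcases eq_or_lt_of_le (hnn s z) with h | h
    · simp [← h]
    · have h₁ : 0 < ∑ z', ∑ x with f x = s, p x z' :=
        h.trans_le (Finset.single_le_sum (fun z' _ => hnn s z') (Finset.mem_univ z))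
      have h₂ : 0 < ∑ s', ∑ x with f x = s', p x z :=
        h.trans_le (Finset.single_le_sum (f := fun s' => ∑ x with f x = s', p x z)
          (fun s' _ => hnn s' z) (Finset.mem_univ s))
      rw [Real.log_div h.ne' (mul_pos h₁ h₂).ne', Real.log_mul h₁.ne' h₂.ne']
      ring
  unfold miFun negEntropy
  simp only [hterm, Finset.sum_sub_distrib, ← Finset.sum_mul]
  rw [Finset.sum_comm, Finset.sum_comm (f := fun s z => (∑ x with f x = s, p x z) *
    Real.log (∑ s', ∑ x with f x = s', p x z))]
  simp only [← Finset.sum_mul]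
  have hcomm : ∀ s, ∑ z, ∑ x with f x = s, p x z = ∑ x with f x = s, ∑ z, p x z :=
    fun s => Finset.sum_comm
  simp only [hcomm]
  ring

/-- Mutual information inequality for `n` uses of stochastic channels under single-use
domination in the sense of `negEntropy`. -/
lemma miFun_pi_le [DecidableEq S] {X Y Z : Type*} [Fintype X] [Fintype Y] [Fintype Z]
    {B : X → Y → ℝ} {E : X → Z → ℝ} (hB : ∀ x y, 0 ≤ B x y) (hE : ∀ x z, 0 ≤ E x z)
    (hB₁ : ∀ x, ∑ y, B x y = 1) (hE₁ : ∀ x, ∑ z, E x z = 1)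
    (h : ∀ v : X → S → ℝ, (∀ x s, 0 ≤ v x s) →
      ∑ y, negEntropy (fun s => ∑ x, v x s * B x y) ≤
        ∑ z, negEntropy (fun s => ∑ x, v x s * E x z))
    {n : ℕ} {c : ℝ} (hc : 0 ≤ c) (f : (Fin n → X) → S) :
    miFun (fun x (y : Fin n → Y) => c * ∏ i, B (x i) (y i)) f ≤
      miFun (fun x (z : Fin n → Z) => c * ∏ i, E (x i) (z i)) f := by
  classical
  have hsumB : ∀ x : Fin n → X, ∑ y : Fin n → Y, c * ∏ i, B (x i) (y i) = c := fun x => by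
    rw [← Finset.mul_sum, ← Fintype.prod_sum fun i y => B (x i) y]
    simp [hB₁]
  have hsumE : ∀ x : Fin n → X, ∑ z : Fin n → Z, c * ∏ i, E (x i) (z i) = c := fun x => by
    rw [← Finset.mul_sum, ← Fintype.prod_sum fun i z => E (x i) z]
    simp [hE₁]
  rw [miFun_eq fun x y => mul_nonneg hc (Finset.prod_nonneg fun i _ => hB _ _),
    miFun_eq fun x z => mul_nonneg hc (Finset.prod_nonneg fun i _ => hE _ _)]
  simp only [hsumB, hsumE]
  have key := sum_negEntropy_pi_le hB hE h n (fun x s => if f x = s then c else 0)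
    (fun x s => by split_ifs <;> simp [hc])
  simp only [ite_mul, zero_mul, ← Finset.sum_filter] at key
  linarith

end LessNoisy

/-- BEC(4ε(1-ε)) is less noisy than BSC(ε), tensorized: for `X^n`
uniform on `F_2^n`, `Z^n` through the BSC(ε), `Z̄^n` through the BEC(4ε(1-ε)), and any
function `S_n = f(X^n)` into a finite set, `I(S_n; Z^n) ≤ I(S_n; Z̄^n)`. -/
theorem mi_bsc_le_mi_bec (n : ℕ) (ε : ℝ) (hε0 : 0 < ε) (hε1 : ε < 1 / 2)
    (S : Type*) [Fintype S] [DecidableEq S] (f : (Fin n → ZMod 2) → S) :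
    miFun (bscJointN n ε) f ≤ miFun (becJointN n (4 * ε * (1 - ε))) f := by
  set l := 1 - 2 * ε with hl
  have hl₀ : 0 ≤ l := by linarith
  have hl₁ : l ≤ 1 := by linarith
  have hδ : 4 * ε * (1 - ε) = 1 - l ^ 2 := by rw [hl]; ring
  have hδ₀ : 0 ≤ 1 - l ^ 2 := by nlinarith
  have hε : ε = (1 - l) / 2 := by rw [hl]; ring
  have hε' : 1 - ε = (1 + l) / 2 := by rw [hl]; ring
  rw [hδ]
  refine miFun_pi_le (B := fun x y : ZMod 2 => if y = x then 1 - ε else ε)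
    (E := fun (x : ZMod 2) (z : Option (ZMod 2)) =>
      if z = some x then 1 - (1 - l ^ 2) else if z = none then 1 - l ^ 2 else 0)
    ?_ ?_ ?_ ?_ ?_ (by positivity) f
  · intro x y
    split_ifs <;> linarith
  · intro x z
    split_ifs <;> nlinarith
  · intro x
    obtain rfl | rfl : x = 0 ∨ x = 1 := by revert x; decide
    all_goals simp [sum_zmod_two]
  · intro x
    obtain rfl | rfl : x = 0 ∨ x = 1 := by revert x; decide
    all_goals simp [Fintype.sum_option]
  · intro v hv
    have h := negEntropy_bsc_le_bec hl₀ hl₁ (hv 0) (hv 1)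
    rw [← hε, ← hε'] at h
    have e : ∀ c : ℝ, negEntropy (fun s => v 0 s * c) = c * negEntropy (v 0) := fun c => by
      rw [← negEntropy_mul]; simp only [mul_comm]
    have e' : ∀ c : ℝ, negEntropy (fun s => v 1 s * c) = c * negEntropy (v 1) := fun c => by
      rw [← negEntropy_mul]; simp only [mul_comm]
    have e'' : ∀ c : ℝ, negEntropy (fun s => v 0 s * c + v 1 s * c) =
        c * negEntropy (fun s => v 0 s + v 1 s) := fun c => by
      rw [← negEntropy_mul]; simp only [mul_comm, mul_add]
    simp [sum_zmod_two, Fintype.sum_option, e, e', e'']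
    simp only [mul_comm] at h ⊢
    linarith
end

section
/- Fix 0 < ε < 1/2 and a rate R with 0 ≤ R ≤ log 2. There exists a sequence of k_n × n matrices M_n over F_2 with liminf_{n→∞} (k_n/n) log 2 ≥ R such that, with X^n uniform on F_2^n, S_n = X^n M_n^T, and Z^n the output of n independent uses of the binary symmetric channel BSC(ε) with input X^n, liminf_{n→∞} −(1/n) log I(S_n; Z^n) ≥ E_x(R, 1 − 4ε(1−ε)), where E_x(R, δ) := sup_{θ ≥ 1} θ·( log 2 − R − log(1 + δ^{1/θ}) ). -/
open scoped BigOperators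

/-- Joint pmf of `S = X M^T` and `Z^n` for the BSC(ε). -/
noncomputable def jointSZbsc (k n : ℕ) (M : Matrix (Fin k) (Fin n) (ZMod 2)) (ε : ℝ)
    (s : Fin k → ZMod 2) (z : Fin n → ZMod 2) : ℝ :=
  ∑ x ∈ Finset.univ.filter fun x => M.mulVec x = s, bscJointN n ε x z

/-- Leaked information `I(S_n; Z^n)` in nats, for `S_n = X M^T` with `X` uniform on
`F_2^n` and `Z^n` the output of the BSC(ε) with input `X`. -/
noncomputable def leakBSC (k n : ℕ) (M : Matrix (Fin k) (Fin n) (ZMod 2)) (ε : ℝ) : ℝ :=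
  ∑ s : Fin k → ZMod 2, ∑ z : Fin n → ZMod 2,
    jointSZbsc k n M ε s z *
      Real.log (jointSZbsc k n M ε s z /
        ((∑ z', jointSZbsc k n M ε s z') * (∑ s', jointSZbsc k n M ε s' z)))

/-- The expurgation exponent `E_x(R, δ) = sup_{θ ≥ 1} θ (log 2 - R - log(1 + δ^{1/θ}))`
of the binary erasure channel with erasure probability `δ`. -/
noncomputable def Ex (R δ : ℝ) : ℝ :=
  sSup {y : ℝ | ∃ θ : ℝ, 1 ≤ θ ∧
    y = θ * (Real.log 2 - R - Real.log (1 + δ ^ (1 / θ)))}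

section LeakExponent

open Finset

/-- The nontrivial real character of `ZMod 2`. -/
noncomputable def parityChar (a : ZMod 2) : ℝ := if a = 0 then 1 else -1

/-- `t` raised to the Hamming weight of `c`. -/
noncomputable def weightPow {n : ℕ} (t : ℝ) (c : Fin n → ZMod 2) : ℝ :=
  ∏ i, if c i = 0 then 1 else t

/-- Weight enumerator, evaluated at `t`, of the nonzero combinations of the rows of `M`. -/
noncomputable def rowWeightSum {k n : ℕ} (t : ℝ) (M : Matrix (Fin k) (Fin n) (ZMod 2)) : ℝ :=
  ∑ u ∈ univ.erase 0, weightPow t (Matrix.vecMul u M)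

lemma zmod_two_eq_zero_or_one (a : ZMod 2) : a = 0 ∨ a = 1 := by
  revert a; decide

lemma parityChar_add (a b : ZMod 2) :
    parityChar (a + b) = parityChar a * parityChar b := by
  have h : (1 : ZMod 2) + 1 = 0 := by decide
  rcases zmod_two_eq_zero_or_one a with rfl | rfl <;> rcases zmod_two_eq_zero_or_one b with rfl | rfl <;>
    simp [parityChar, h]

lemma parityChar_mul_self (a : ZMod 2) : parityChar a * parityChar a = 1 := by
  unfold parityChar; split_ifs <;> norm_num

lemma parityChar_sum {ι : Type*} (s : Finset ι) (f : ι → ZMod 2) :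
    parityChar (∑ i ∈ s, f i) = ∏ i ∈ s, parityChar (f i) := by
  classical
  induction s using Finset.induction_on with
  | empty => simp [parityChar]
  | insert a s ha ih => rw [sum_insert ha, prod_insert ha, parityChar_add, ih]

lemma sum_zmod_two_s10 {A : Type*} [AddCommMonoid A] (f : ZMod 2 → A) :
    ∑ a, f a = f 0 + f 1 := Fin.sum_univ_two f

lemma sum_prod_zmod_two {n : ℕ} (f : Fin n → ZMod 2 → ℝ) :
    ∑ c : Fin n → ZMod 2, ∏ i, f i (c i) = ∏ i, (f i 0 + f i 1) := by
  simp_rw [← sum_zmod_two_s10]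
  rw [prod_univ_sum, Fintype.piFinset_univ]

lemma sum_weightPow {n : ℕ} (t : ℝ) :
    ∑ c : Fin n → ZMod 2, weightPow t c = (1 + t) ^ n := by
  simp [weightPow, sum_prod_zmod_two (fun (_ : Fin n) a => if a = 0 then (1 : ℝ) else t)]

lemma weightPow_zero_vec {n : ℕ} (t : ℝ) : weightPow t (0 : Fin n → ZMod 2) = 1 := by
  simp [weightPow]

lemma weightPow_sq {n : ℕ} (t : ℝ) (c : Fin n → ZMod 2) :
    weightPow t c ^ 2 = weightPow (t ^ 2) c := by
  rw [weightPow, weightPow, ← prod_pow]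
  refine prod_congr rfl fun i _ => ?_
  split_ifs <;> simp

lemma weightPow_nonneg {n : ℕ} {t : ℝ} (ht : 0 ≤ t) (c : Fin n → ZMod 2) :
    0 ≤ weightPow t c :=
  prod_nonneg fun i _ => by split_ifs <;> linarith

lemma weightPow_le_one {n : ℕ} {t : ℝ} (ht : 0 ≤ t) (ht1 : t ≤ 1) (c : Fin n → ZMod 2) :
    weightPow t c ≤ 1 :=
  prod_le_one (fun i _ => by split_ifs <;> linarith) fun i _ => by split_ifs <;> linarith

lemma weightPow_lt_one {n : ℕ} {t : ℝ} (ht : 0 < t) (ht1 : t < 1) {c : Fin n → ZMod 2}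
    (hc : c ≠ 0) : weightPow t c < 1 := by
  obtain ⟨i, hi⟩ := Function.ne_iff.1 hc
  have h : weightPow t c < ∏ _i : Fin n, (1 : ℝ) :=
    prod_lt_prod (fun i _ => by split_ifs <;> linarith) (fun i _ => by split_ifs <;> linarith)
      ⟨i, mem_univ i, by simpa [show c i ≠ 0 from hi] using ht1⟩
  simpa using h

lemma pow_le_weightPow {n : ℕ} {t : ℝ} (ht : 0 ≤ t) (ht1 : t ≤ 1) (c : Fin n → ZMod 2) :
    t ^ n ≤ weightPow t c := by
  have h : ∏ _i : Fin n, t ≤ weightPow t c :=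
    prod_le_prod (fun _ _ => ht) fun i _ => by split_ifs <;> linarith
  simpa using h

lemma weightPow_rpow {n : ℕ} {t : ℝ} (ht : 0 ≤ t) (r : ℝ) (c : Fin n → ZMod 2) :
    weightPow t c ^ r = weightPow (t ^ r) c := by
  rw [weightPow, weightPow, ← Real.finsetProd_rpow _ _ fun i _ => by split_ifs <;> linarith]
  refine prod_congr rfl fun i _ => ?_
  split_ifs <;> simp

lemma sum_parityChar_dotProduct {k : ℕ} (s : Fin k → ZMod 2) :
    ∑ u : Fin k → ZMod 2, parityChar (u ⬝ᵥ s) = if s = 0 then 2 ^ k else 0 := by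
  simp only [dotProduct, parityChar_sum]
  rw [sum_prod_zmod_two (fun i a => parityChar (a * s i))]
  split_ifs with h
  · subst h; norm_num [parityChar]
  · obtain ⟨i, hi⟩ := Function.ne_iff.1 h
    refine prod_eq_zero (mem_univ i) ?_
    simp [parityChar, show s i ≠ 0 from hi]

lemma sum_sq_sum_mul_parityChar {k : ℕ} (p : (Fin k → ZMod 2) → ℝ) :
    ∑ u : Fin k → ZMod 2, (∑ s, p s * parityChar (u ⬝ᵥ s)) ^ 2 = 2 ^ k * ∑ s, p s ^ 2 := by
  have h : ∀ s s' : Fin k → ZMod 2, s + s' = 0 ↔ s = s' := fun s s' => by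
    rw [add_eq_zero_iff_eq_neg]
    have : -s' = s' := by ext i; exact ZMod.neg_eq_self_mod_two (s' i)
    rw [this]
  calc
    _ = ∑ u : Fin k → ZMod 2, ∑ s, ∑ s', p s * p s' * parityChar (u ⬝ᵥ (s + s')) := by
      refine sum_congr rfl fun u _ => ?_
      rw [sq, sum_mul_sum]
      refine sum_congr rfl fun s _ => sum_congr rfl fun s' _ => ?_
      rw [dotProduct_add, parityChar_add]; ring
    _ = ∑ s, ∑ s', p s * p s' * ∑ u : Fin k → ZMod 2, parityChar (u ⬝ᵥ (s + s')) := by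
      rw [sum_comm]
      refine sum_congr rfl fun s _ => ?_
      rw [sum_comm]
      simp_rw [mul_sum]
    _ = _ := by
      simp_rw [sum_parityChar_dotProduct, h, mul_ite, mul_zero, sum_ite_eq, mem_univ, if_true,
        mul_sum]
      exact sum_congr rfl fun s _ => by ring

lemma sum_bscJointN_mul_parityChar {n : ℕ} (ε : ℝ) (c z : Fin n → ZMod 2) :
    ∑ x, bscJointN n ε x z * parityChar (c ⬝ᵥ x) =
      1 / 2 ^ n * (parityChar (c ⬝ᵥ z) * weightPow (1 - 2 * ε) c) := by
  simp only [dotProduct, parityChar_sum, bscJointN, weightPow, mul_assoc, ← mul_sum,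
    ← prod_mul_distrib]
  rw [sum_prod_zmod_two
    (fun i a => (if z i = a then 1 - ε else ε) * parityChar (c i * a))]
  congr 1
  refine prod_congr rfl fun i _ => ?_
  rcases zmod_two_eq_zero_or_one (c i) with h | h <;> rcases zmod_two_eq_zero_or_one (z i) with h' | h' <;>
    simp [h, h', parityChar] <;> ring

lemma sum_jointSZbsc_mul_parityChar {k n : ℕ} (M : Matrix (Fin k) (Fin n) (ZMod 2)) (ε : ℝ)
    (u : Fin k → ZMod 2) (z : Fin n → ZMod 2) :
    ∑ s, jointSZbsc k n M ε s z * parityChar (u ⬝ᵥ s) =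
      1 / 2 ^ n * (parityChar (Matrix.vecMul u M ⬝ᵥ z) *
        weightPow (1 - 2 * ε) (Matrix.vecMul u M)) := by
  rw [← sum_bscJointN_mul_parityChar, ← sum_fiberwise univ (fun x => M.mulVec x)]
  refine sum_congr rfl fun s _ => ?_
  rw [jointSZbsc, sum_mul]
  refine sum_congr rfl fun x hx => ?_
  rw [← (mem_filter.1 hx).2, Matrix.dotProduct_mulVec]

lemma sum_jointSZbsc {k n : ℕ} (M : Matrix (Fin k) (Fin n) (ZMod 2)) (ε : ℝ)
    (z : Fin n → ZMod 2) : ∑ s, jointSZbsc k n M ε s z = 1 / 2 ^ n := by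
  have h := sum_jointSZbsc_mul_parityChar M ε 0 z
  simpa [parityChar, weightPow_zero_vec] using h

lemma sum_sum_jointSZbsc {k n : ℕ} (M : Matrix (Fin k) (Fin n) (ZMod 2)) (ε : ℝ) :
    ∑ s, ∑ z, jointSZbsc k n M ε s z = 1 := by
  rw [sum_comm]
  simp [sum_jointSZbsc]

lemma jointSZbsc_nonneg {k n : ℕ} (M : Matrix (Fin k) (Fin n) (ZMod 2)) {ε : ℝ} (hε0 : 0 ≤ ε)
    (hε1 : ε ≤ 1) (s : Fin k → ZMod 2) (z : Fin n → ZMod 2) : 0 ≤ jointSZbsc k n M ε s z :=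
  sum_nonneg fun x _ => mul_nonneg (by positivity) <|
    prod_nonneg fun i _ => by split_ifs <;> linarith

lemma sum_sq_jointSZbsc {k n : ℕ} (M : Matrix (Fin k) (Fin n) (ZMod 2)) (ε : ℝ) :
    2 ^ k * 2 ^ n * ∑ s, ∑ z, jointSZbsc k n M ε s z ^ 2 =
      1 + rowWeightSum ((1 - 2 * ε) ^ 2) M := by
  have hz : ∀ z : Fin n → ZMod 2, 2 ^ k * ∑ s, jointSZbsc k n M ε s z ^ 2 =
      (1 / 2 ^ n) ^ 2 * ∑ u, weightPow ((1 - 2 * ε) ^ 2) (Matrix.vecMul u M) := fun z => by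
    rw [← sum_sq_sum_mul_parityChar, mul_sum]
    refine sum_congr rfl fun u _ => ?_
    rw [sum_jointSZbsc_mul_parityChar, mul_pow, mul_pow, weightPow_sq, sq (parityChar _),
      parityChar_mul_self, one_mul]
  have h1 : ∑ u, weightPow ((1 - 2 * ε) ^ 2) (Matrix.vecMul u M) =
      1 + rowWeightSum ((1 - 2 * ε) ^ 2) M := by
    rw [rowWeightSum, ← add_sum_erase univ _ (mem_univ 0), Matrix.zero_vecMul,
      weightPow_zero_vec]
  rw [sum_comm, mul_comm (2 ^ k : ℝ), mul_assoc, mul_sum]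
  simp_rw [hz, h1]
  simp
  field_simp

lemma leakBSC_le_rowWeightSum {k n : ℕ} (M : Matrix (Fin k) (Fin n) (ZMod 2)) {ε : ℝ}
    (hε0 : 0 ≤ ε) (hε1 : ε ≤ 1) :
    leakBSC k n M ε ≤ rowWeightSum ((1 - 2 * ε) ^ 2) M := by
  have hp := jointSZbsc_nonneg M hε0 hε1
  have hterm : ∀ s z, jointSZbsc k n M ε s z * Real.log (jointSZbsc k n M ε s z /
      ((∑ z', jointSZbsc k n M ε s z') * (∑ s', jointSZbsc k n M ε s' z))) ≤
      2 ^ k * 2 ^ n * jointSZbsc k n M ε s z ^ 2 - 2 * jointSZbsc k n M ε s z +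
        jointSZbsc k n M ε s z / (2 ^ k * ∑ z', jointSZbsc k n M ε s z') := fun s z => by
    rw [sum_jointSZbsc]
    have hq : jointSZbsc k n M ε s z ≤ ∑ z', jointSZbsc k n M ε s z' :=
      single_le_sum (f := fun z' => jointSZbsc k n M ε s z') (fun z' _ => hp s z') (mem_univ z)
    generalize ∑ z', jointSZbsc k n M ε s z' = q at hq ⊢
    rcases (hp s z).eq_or_lt with h | h
    · simp [← h]
    · generalize jointSZbsc k n M ε s z = p at h hq ⊢
      have hq0 : 0 < q := h.trans_le hq
      have e : p / (q * (1 / 2 ^ n)) = (2 ^ k * 2 ^ n * p) * (1 / (2 ^ k * q)) := by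
        field_simp
      rw [e, Real.log_mul (by positivity) (by positivity)]
      have h1 := Real.log_le_sub_one_of_pos (x := 2 ^ k * 2 ^ n * p) (by positivity)
      have h2 := Real.log_le_sub_one_of_pos (x := 1 / (2 ^ k * q)) (by positivity)
      calc _ ≤ p * ((2 ^ k * 2 ^ n * p - 1) + (1 / (2 ^ k * q) - 1)) := by gcongr
        _ = _ := by ring
  have hlast : ∑ s, ∑ z, jointSZbsc k n M ε s z / (2 ^ k * ∑ z', jointSZbsc k n M ε s z') ≤
      1 := by
    calc _ ≤ ∑ _s : Fin k → ZMod 2, (1 : ℝ) / 2 ^ k := by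
          refine sum_le_sum fun s _ => ?_
          rw [← sum_div, ← div_div, div_right_comm]
          gcongr
          exact div_self_le_one _
      _ = 1 := by simp
  have hsum := sum_sq_jointSZbsc M ε
  have hone := sum_sum_jointSZbsc M ε
  refine (sum_le_sum fun s _ => sum_le_sum fun z _ => hterm s z).trans ?_
  simp only [sum_add_distrib, sum_sub_distrib, ← mul_sum]
  rw [hsum, hone]
  linarith

lemma sub_add_sq_le_mul_log_div {p q : ℝ} (hp0 : 0 ≤ p) (hp1 : p ≤ 1) (hq0 : 0 ≤ q)
    (hq1 : q ≤ 1) (hpq : q = 0 → p = 0) :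
    p - q + (p - q) ^ 2 / 4 ≤ p * Real.log (p / q) := by
  rcases hp0.eq_or_lt with h | h
  · subst h; nlinarith
  have hq : 0 < q := hq0.lt_of_ne fun e => h.ne' (hpq e.symm)
  obtain ⟨a, ha, rfl⟩ : ∃ a, 0 < a ∧ a ^ 2 = p := ⟨√p, Real.sqrt_pos.2 h, Real.sq_sqrt hp0⟩
  obtain ⟨b, hb, rfl⟩ : ∃ b, 0 < b ∧ b ^ 2 = q := ⟨√q, Real.sqrt_pos.2 hq, Real.sq_sqrt hq0⟩
  have ha1 : a ≤ 1 := by nlinarith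
  have hb1 : b ≤ 1 := by nlinarith
  have hlog : Real.log (a ^ 2 / b ^ 2) = -2 * Real.log (b / a) := by
    rw [← div_pow, Real.log_pow, ← inv_div b a, Real.log_inv]; push_cast; ring
  have h1 := Real.log_le_sub_one_of_pos (div_pos hb ha)
  have h2 : a ^ 2 * (-2 * (b / a - 1)) ≤ a ^ 2 * (-2 * Real.log (b / a)) := by
    gcongr ?_ * ?_; linarith
  have h3 : a ^ 2 * (-2 * (b / a - 1)) = 2 * a ^ 2 - 2 * a * b := by field_simp; ring
  rw [hlog]
  have h4 : (a ^ 2 - b ^ 2) ^ 2 ≤ 4 * (a - b) ^ 2 := by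
    have : (a + b) ^ 2 ≤ 4 := by nlinarith
    nlinarith [sq_nonneg (a - b)]
  nlinarith

lemma sum_sq_sub_le_leakBSC {k n : ℕ} (M : Matrix (Fin k) (Fin n) (ZMod 2)) {ε : ℝ}
    (hε0 : 0 ≤ ε) (hε1 : ε ≤ 1) :
    (∑ s, ∑ z, (jointSZbsc k n M ε s z -
      (∑ z', jointSZbsc k n M ε s z') * (1 / 2 ^ n)) ^ 2) / 4 ≤ leakBSC k n M ε := by
  have hp := jointSZbsc_nonneg M hε0 hε1
  have hle : ∀ s z, jointSZbsc k n M ε s z ≤ ∑ z', jointSZbsc k n M ε s z' := fun s z =>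
    single_le_sum (f := fun z' => jointSZbsc k n M ε s z') (fun z' _ => hp s z') (mem_univ z)
  have hmarg : ∀ s, ∑ z', jointSZbsc k n M ε s z' ≤ 1 := fun s => by
    rw [← sum_sum_jointSZbsc M ε]
    exact single_le_sum (f := fun s => ∑ z', jointSZbsc k n M ε s z')
      (fun s _ => sum_nonneg fun z _ => hp s z) (mem_univ s)
  have hmarg0 : ∀ s, 0 ≤ ∑ z', jointSZbsc k n M ε s z' := fun s =>
    sum_nonneg fun z _ => hp s z
  have hpow : (1 : ℝ) / 2 ^ n ≤ 1 :=
    (div_le_one (by positivity)).2 (one_le_pow₀ one_le_two)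
  have hterm : ∀ s z, jointSZbsc k n M ε s z -
      (∑ z', jointSZbsc k n M ε s z') * (1 / 2 ^ n) +
      (jointSZbsc k n M ε s z - (∑ z', jointSZbsc k n M ε s z') * (1 / 2 ^ n)) ^ 2 / 4 ≤
      jointSZbsc k n M ε s z * Real.log (jointSZbsc k n M ε s z /
        ((∑ z', jointSZbsc k n M ε s z') * (∑ s', jointSZbsc k n M ε s' z))) := fun s z => by
    rw [sum_jointSZbsc]
    refine sub_add_sq_le_mul_log_div (hp s z) ((hle s z).trans (hmarg s))
      (mul_nonneg (hmarg0 s) (by positivity)) (mul_le_one₀ (hmarg s) (by positivity) hpow)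
      fun h => ?_
    have h0 : ∑ z', jointSZbsc k n M ε s z' = 0 :=
      (mul_eq_zero.1 h).resolve_right (by positivity)
    exact le_antisymm ((hle s z).trans h0.le) (hp s z)
  refine le_trans (le_of_eq ?_) (sum_le_sum fun s _ => sum_le_sum fun z _ => hterm s z)
  have hprod : ∑ s, ∑ _z : Fin n → ZMod 2,
      (∑ z', jointSZbsc k n M ε s z') * ((1 : ℝ) / 2 ^ n) = 1 := by
    simp_rw [← mul_sum, ← sum_mul]
    rw [sum_sum_jointSZbsc]
    simp
  simp only [sum_add_distrib, sum_sub_distrib, ← sum_div]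
  rw [hprod, sum_sum_jointSZbsc]
  ring

lemma pow_div_le_leakBSC {k n : ℕ} {M : Matrix (Fin k) (Fin n) (ZMod 2)} (hM : M ≠ 0) {ε : ℝ}
    (hε0 : 0 ≤ ε) (hε1 : ε ≤ 1 / 2) :
    ((1 - 2 * ε) ^ n) ^ 2 / (4 * (2 ^ k * 2 ^ n)) ≤ leakBSC k n M ε := by
  obtain ⟨i, hi⟩ : ∃ i, M i ≠ 0 := Function.ne_iff.1 hM
  set c := M i with hc
  have hrow : Matrix.vecMul (Pi.single i 1) M = c := by rw [Matrix.single_one_vecMul]; rfl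
  let D : (Fin k → ZMod 2) → (Fin n → ZMod 2) → ℝ := fun s z =>
    jointSZbsc k n M ε s z - (∑ z', jointSZbsc k n M ε s z') * (1 / 2 ^ n)
  have hcorr : ∑ s, ∑ z, D s z * (parityChar (Pi.single i 1 ⬝ᵥ s) * parityChar (c ⬝ᵥ z)) =
      weightPow (1 - 2 * ε) c := by
    have h1 : ∑ s, ∑ z, jointSZbsc k n M ε s z *
        (parityChar (Pi.single i 1 ⬝ᵥ s) * parityChar (c ⬝ᵥ z)) =
        weightPow (1 - 2 * ε) c := by
      rw [sum_comm]
      have hz : ∀ z, ∑ s, jointSZbsc k n M ε s z *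
          (parityChar (Pi.single i 1 ⬝ᵥ s) * parityChar (c ⬝ᵥ z)) =
          1 / 2 ^ n * weightPow (1 - 2 * ε) c := fun z => by
        simp_rw [← mul_assoc, ← sum_mul, sum_jointSZbsc_mul_parityChar, hrow]
        linear_combination (1 / 2 ^ n * weightPow (1 - 2 * ε) c) *
          parityChar_mul_self (c ⬝ᵥ z)
      rw [sum_congr rfl fun z _ => hz z]
      simp
    have h2 : ∑ s, ∑ z, (∑ z', jointSZbsc k n M ε s z') * (1 / 2 ^ n) *
        (parityChar (Pi.single i 1 ⬝ᵥ s) * parityChar (c ⬝ᵥ z)) = 0 := by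
      refine sum_eq_zero fun s _ => ?_
      simp_rw [← mul_assoc, ← mul_sum, dotProduct_comm c, sum_parityChar_dotProduct]
      simp [hi]
    simp only [D, sub_mul, sum_sub_distrib]
    rw [h1, h2, sub_zero]
  have hcs : weightPow (1 - 2 * ε) c ^ 2 ≤ (∑ s, ∑ z, D s z ^ 2) * (2 ^ k * 2 ^ n) := by
    rw [← hcorr]
    simp only [← Fintype.sum_prod_type']
    refine (sum_mul_sq_le_sq_mul_sq _ _ _).trans (le_of_eq ?_)
    congr 1
    simp_rw [mul_pow, sq, parityChar_mul_self]
    simp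
  have hpow : ((1 - 2 * ε) ^ n) ^ 2 ≤ weightPow (1 - 2 * ε) c ^ 2 :=
    pow_le_pow_left₀ (pow_nonneg (by linarith) n)
      (pow_le_weightPow (by linarith) (by linarith) c) 2
  refine le_trans ?_ (sum_sq_sub_le_leakBSC M hε0 (by linarith))
  rw [div_le_div_iff₀ (by positivity) (by norm_num)]
  change _ ≤ (∑ s, ∑ z, D s z ^ 2) * _
  linarith

lemma sum_matrix_vecMul {k n : ℕ} {u : Fin k → ZMod 2} (hu : u ≠ 0)
    (f : (Fin n → ZMod 2) → ℝ) :
    2 ^ n * ∑ M : Matrix (Fin k) (Fin n) (ZMod 2), f (Matrix.vecMul u M) =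
      Fintype.card (Matrix (Fin k) (Fin n) (ZMod 2)) * ∑ c, f c := by
  obtain ⟨i, hi⟩ := Function.ne_iff.1 hu
  have hi1 : u i = 1 := (zmod_two_eq_zero_or_one (u i)).resolve_left hi
  have hshift : ∀ c : Fin n → ZMod 2,
      ∑ M : Matrix (Fin k) (Fin n) (ZMod 2), f (Matrix.vecMul u M) =
        ∑ M : Matrix (Fin k) (Fin n) (ZMod 2), f (Matrix.vecMul u M + c) := fun c => by
    rw [← Equiv.sum_comp (Equiv.addRight (Matrix.vecMulVec (Pi.single i 1) c))]
    refine sum_congr rfl fun M _ => ?_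
    rw [Equiv.coe_addRight, Matrix.vecMul_add, Matrix.vecMul_vecMulVec]
    simp [hi1]
  calc _ = ∑ _c : Fin n → ZMod 2,
        ∑ M : Matrix (Fin k) (Fin n) (ZMod 2), f (Matrix.vecMul u M) := by simp
    _ = ∑ M : Matrix (Fin k) (Fin n) (ZMod 2), ∑ c, f (Matrix.vecMul u M + c) := by
      rw [sum_congr rfl fun c _ => hshift c, sum_comm]
    _ = ∑ _M : Matrix (Fin k) (Fin n) (ZMod 2), ∑ c, f c :=
      sum_congr rfl fun M _ => Equiv.sum_comp (Equiv.addLeft (Matrix.vecMul u M)) f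
    _ = _ := by simp

lemma sum_rowWeightSum_le (k n : ℕ) {t : ℝ} (ht : 0 ≤ t) :
    ∑ M : Matrix (Fin k) (Fin n) (ZMod 2), rowWeightSum t M ≤
      Fintype.card (Matrix (Fin k) (Fin n) (ZMod 2)) * (2 ^ k * ((1 + t) / 2) ^ n) := by
  have hu : ∀ u ∈ univ.erase (0 : Fin k → ZMod 2),
      ∑ M : Matrix (Fin k) (Fin n) (ZMod 2), weightPow t (Matrix.vecMul u M) =
        Fintype.card (Matrix (Fin k) (Fin n) (ZMod 2)) * ((1 + t) / 2) ^ n := fun u hu => by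
    have h := sum_matrix_vecMul (n := n) (ne_of_mem_erase hu) (weightPow t)
    rw [sum_weightPow] at h
    rw [div_pow, mul_div_assoc', eq_div_iff (by positivity), ← h, mul_comm]
  simp only [rowWeightSum]
  rw [sum_comm, sum_congr rfl hu, sum_const, nsmul_eq_mul, mul_left_comm]
  gcongr
  refine (Nat.cast_le.2 (card_le_card (erase_subset _ _))).trans (le_of_eq ?_)
  simp

lemma rpow_sum_le_sum_rpow_of_le_one {ι : Type*} (s : Finset ι) {f : ι → ℝ} {r : ℝ}
    (hf : ∀ i, 0 ≤ f i) (hr0 : 0 < r) (hr1 : r ≤ 1) :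
    (∑ i ∈ s, f i) ^ r ≤ ∑ i ∈ s, f i ^ r := by
  classical
  induction s using Finset.induction_on with
  | empty => simp [Real.zero_rpow hr0.ne']
  | insert a s ha ih =>
    rw [sum_insert ha, sum_insert ha]
    exact (Real.rpow_add_le_add_rpow (hf a) (sum_nonneg fun i _ => hf i) hr0.le hr1).trans
      (by gcongr)

lemma rowWeightSum_nonneg {k n : ℕ} {t : ℝ} (ht : 0 ≤ t)
    (M : Matrix (Fin k) (Fin n) (ZMod 2)) : 0 ≤ rowWeightSum t M :=
  sum_nonneg fun _ _ => weightPow_nonneg ht _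

lemma rowWeightSum_rpow_le {k n : ℕ} {t r : ℝ} (ht : 0 ≤ t) (hr0 : 0 < r) (hr1 : r ≤ 1)
    (M : Matrix (Fin k) (Fin n) (ZMod 2)) :
    rowWeightSum t M ^ r ≤ rowWeightSum (t ^ r) M := by
  simp only [rowWeightSum, ← weightPow_rpow ht]
  exact rpow_sum_le_sum_rpow_of_le_one _ (fun u => weightPow_nonneg ht _) hr0 hr1

lemma exists_rowWeightSum_lt_zero_matrix {k n : ℕ} (hk : 0 < k) (hn : 0 < n) {t : ℝ}
    (ht0 : 0 < t) (ht1 : t < 1) :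
    ∃ M : Matrix (Fin k) (Fin n) (ZMod 2),
      rowWeightSum t M < rowWeightSum t (0 : Matrix (Fin k) (Fin n) (ZMod 2)) := by
  refine ⟨Matrix.of fun _ _ => 1, sum_lt_sum (fun u _ => ?_) ⟨Pi.single ⟨0, hk⟩ 1, ?_, ?_⟩⟩
  · rw [Matrix.vecMul_zero, weightPow_zero_vec]
    exact weightPow_le_one ht0.le ht1.le _
  · simp
  · rw [Matrix.vecMul_zero, weightPow_zero_vec, Matrix.single_one_vecMul]
    exact weightPow_lt_one ht0 ht1 fun h => one_ne_zero (congrFun h ⟨0, hn⟩)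

/-- Expurgation: a single nonzero matrix meets the random-coding bound on the moment of order
`1 / θ` of the weight enumerator for every `θ ≥ 1` at once. -/
lemma exists_matrix_rowWeightSum_rpow_le {k n : ℕ} (hk : 0 < k) (hn : 0 < n) {t : ℝ}
    (ht0 : 0 < t) (ht1 : t < 1) :
    ∃ M : Matrix (Fin k) (Fin n) (ZMod 2), M ≠ 0 ∧ ∀ θ : ℝ, 1 ≤ θ →
      rowWeightSum t M ^ (1 / θ) ≤ 2 ^ k * ((1 + t ^ (1 / θ)) / 2) ^ n := by
  obtain ⟨M, -, hM⟩ := exists_min_image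
    (univ : Finset (Matrix (Fin k) (Fin n) (ZMod 2))) (rowWeightSum t) univ_nonempty
  refine ⟨M, ?_, fun θ hθ => ?_⟩
  · rintro rfl
    obtain ⟨M', hM'⟩ := exists_rowWeightSum_lt_zero_matrix hk hn ht0 ht1
    exact absurd (hM M' (mem_univ _)) hM'.not_ge
  · have hθ0 : 0 < θ := by linarith
    have hr0 : 0 < 1 / θ := by positivity
    have hr1 : 1 / θ ≤ 1 := (div_le_one hθ0).2 hθ
    have h : ∑ _M' : Matrix (Fin k) (Fin n) (ZMod 2), rowWeightSum t M ^ (1 / θ) ≤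
        ∑ M' : Matrix (Fin k) (Fin n) (ZMod 2), rowWeightSum (t ^ (1 / θ)) M' :=
      sum_le_sum fun M' _ =>
        (Real.rpow_le_rpow (rowWeightSum_nonneg ht0.le M) (hM M' (mem_univ _)) hr0.le).trans
          (rowWeightSum_rpow_le ht0.le hr0 hr1 M')
    have h' := h.trans (sum_rowWeightSum_le k n (by positivity))
    rw [sum_const, nsmul_eq_mul, card_univ] at h'
    exact le_of_mul_le_mul_left h' (Nat.cast_pos.2 Fintype.card_pos)

lemma exists_matrix_log_leakBSC_bounds {k n : ℕ} (hk : 0 < k) (hn : 0 < n) {ε : ℝ}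
    (hε0 : 0 < ε) (hε1 : ε < 1 / 2) :
    ∃ M : Matrix (Fin k) (Fin n) (ZMod 2),
      2 * n * Real.log (1 - 2 * ε) - Real.log 4 - k * Real.log 2 - n * Real.log 2 ≤
        Real.log (leakBSC k n M ε) ∧
      ∀ θ : ℝ, 1 ≤ θ → Real.log (leakBSC k n M ε) ≤
        θ * (k * Real.log 2 +
          n * (Real.log (1 + (1 - 4 * ε * (1 - ε)) ^ (1 / θ)) - Real.log 2)) := by
  have hδ : 1 - 4 * ε * (1 - ε) = (1 - 2 * ε) ^ 2 := by ring
  have hρ : 0 < 1 - 2 * ε := by linarith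
  have hδ0 : 0 < (1 - 2 * ε) ^ 2 := by positivity
  obtain ⟨M, hM0, hM⟩ := exists_matrix_rowWeightSum_rpow_le hk hn hδ0 (by nlinarith)
  have hlow := pow_div_le_leakBSC hM0 hε0.le hε1.le
  have hup := leakBSC_le_rowWeightSum M hε0.le (by linarith)
  have hpos : 0 < leakBSC k n M ε := lt_of_lt_of_le (by positivity) hlow
  refine ⟨M, ?_, fun θ hθ => ?_⟩
  · refine le_trans (le_of_eq ?_) (Real.log_le_log (by positivity) hlow)
    rw [Real.log_div (by positivity) (by positivity), Real.log_mul (by positivity) (by positivity),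
      Real.log_mul (by positivity) (by positivity), Real.log_pow, Real.log_pow, Real.log_pow,
      Real.log_pow]
    push_cast; ring
  · have hθ0 : 0 < θ := by linarith
    have h := (Real.rpow_le_rpow hpos.le hup (by positivity)).trans (hM θ hθ)
    have hl := Real.log_le_log (by positivity) h
    have ht : 0 < ((1 - 2 * ε) ^ 2) ^ (1 / θ) := by positivity
    rw [Real.log_rpow hpos, Real.log_mul (by positivity) (by positivity), Real.log_pow,
      Real.log_pow, Real.log_div (by positivity) (by positivity)] at hl
    rw [hδ]
    calc Real.log (leakBSC k n M ε) = θ * (1 / θ * Real.log (leakBSC k n M ε)) := by field_simp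
      _ ≤ _ := by gcongr

lemma le_liminf_of_le_of_tendsto {u v : ℕ → ℝ} {a C : ℝ} (hu : ∀ᶠ n in Filter.atTop, u n ≤ C)
    (hvu : ∀ᶠ n in Filter.atTop, v n ≤ u n) (hv : Filter.Tendsto v Filter.atTop (nhds a)) :
    a ≤ Filter.liminf u Filter.atTop := by
  refine le_of_forall_lt fun b hb => ?_
  obtain ⟨b', hbb', hb'⟩ := exists_between hb
  refine hbb'.trans_le (Filter.le_liminf_of_le
    (Filter.IsCoboundedUnder.of_frequently_le hu.frequently) ?_)
  filter_upwards [hvu, hv.eventually_const_lt hb'] with n h1 h2 using h2.le.trans h1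

end LeakExponent

/-- Theorem 2 of the paper: there is a sequence of linear hash
matrices of rate at least `R` whose leaked information over BSC(ε) decays with exponent
at least `E_x(R, 1 - 4ε(1-ε))`. -/
theorem exists_matrices_leak_exponent_ge_Ex_bsc (ε R : ℝ) (hε0 : 0 < ε)
    (hε1 : ε < 1 / 2) (hR0 : 0 ≤ R) (hR1 : R ≤ Real.log 2) :
    ∃ (kseq : ℕ → ℕ) (Mseq : (n : ℕ) → Matrix (Fin (kseq n)) (Fin n) (ZMod 2)),
      R ≤ Filter.liminf (fun n : ℕ => ((kseq n : ℝ) / n) * Real.log 2) Filter.atTop ∧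
      Ex R (1 - 4 * ε * (1 - ε)) ≤ Filter.liminf
        (fun n : ℕ => -(1 / (n : ℝ)) * Real.log (leakBSC (kseq n) n (Mseq n) ε))
        Filter.atTop := by
  have hlog2 : 0 < Real.log 2 := Real.log_pos one_lt_two
  let kseq : ℕ → ℕ := fun n => ⌊n * R / Real.log 2⌋₊ + 1
  have hM : ∀ n : ℕ, ∃ M : Matrix (Fin (kseq n)) (Fin n) (ZMod 2), 0 < n →
      (2 * n * Real.log (1 - 2 * ε) - Real.log 4 - kseq n * Real.log 2 - n * Real.log 2 ≤
        Real.log (leakBSC (kseq n) n M ε) ∧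
      ∀ θ : ℝ, 1 ≤ θ → Real.log (leakBSC (kseq n) n M ε) ≤
        θ * (kseq n * Real.log 2 +
          n * (Real.log (1 + (1 - 4 * ε * (1 - ε)) ^ (1 / θ)) - Real.log 2))) := fun n => by
    rcases n.eq_zero_or_pos with rfl | hn
    · exact ⟨0, fun h => absurd h (lt_irrefl _)⟩
    · obtain ⟨M, h⟩ := exists_matrix_log_leakBSC_bounds (Nat.succ_pos _) hn hε0 hε1
      exact ⟨M, fun _ => h⟩
  choose Mseq hMseq using hM
  have hk_lower : ∀ n : ℕ, n * R ≤ kseq n * Real.log 2 := fun n => by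
    have h := Nat.lt_floor_add_one (n * R / Real.log 2)
    rw [div_lt_iff₀ hlog2] at h
    simpa [kseq] using h.le
  have hk_upper : ∀ n : ℕ, kseq n * Real.log 2 ≤ n * R + Real.log 2 := fun n => by
    have h := Nat.floor_le (a := n * R / Real.log 2) (by positivity)
    rw [le_div_iff₀ hlog2] at h
    simp only [kseq]
    push_cast
    linarith
  refine ⟨kseq, Mseq, ?_, ?_⟩
  · refine le_liminf_of_le_of_tendsto (C := R + Real.log 2) (v := fun _ => R) ?_ ?_
      tendsto_const_nhds
    all_goals
      filter_upwards [Filter.eventually_ge_atTop 1] with n hn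
      have hn0 : (1 : ℝ) ≤ n := by exact_mod_cast hn
      rw [div_mul_eq_mul_div]
    · rw [div_le_iff₀ (by linarith)]
      nlinarith [hk_upper n]
    · rw [le_div_iff₀ (by linarith)]
      nlinarith [hk_lower n]
  · refine csSup_le ⟨_, 1, le_rfl, rfl⟩ ?_
    rintro _ ⟨θ, hθ, rfl⟩
    set L := Real.log (1 + (1 - 4 * ε * (1 - ε)) ^ (1 / θ)) with hL
    refine le_liminf_of_le_of_tendsto
      (C := -2 * Real.log (1 - 2 * ε) + Real.log 4 + R + 2 * Real.log 2)
      (v := fun n : ℕ => θ * (Real.log 2 - R - L) - θ * Real.log 2 * (1 / (n : ℝ))) ?_ ?_ ?_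
    · filter_upwards [Filter.eventually_ge_atTop 1] with n hn
      have hn0 : (1 : ℝ) ≤ n := by exact_mod_cast hn
      have hlow := (hMseq n hn).1
      have hlog4 : 0 < Real.log 4 := Real.log_pos (by norm_num)
      rw [neg_mul, one_div_mul_eq_div, ← neg_div, div_le_iff₀ (by linarith)]
      nlinarith [hk_upper n]
    · filter_upwards [Filter.eventually_ge_atTop 1] with n hn
      have hn0 : (1 : ℝ) ≤ n := by exact_mod_cast hn
      have hup := (hMseq n hn).2 θ hθ
      have hk := mul_le_mul_of_nonneg_left (hk_upper n) (by linarith : 0 ≤ θ)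
      rw [← hL] at hup
      rw [neg_mul, one_div_mul_eq_div, ← neg_div, le_div_iff₀ (by linarith), sub_mul,
        mul_assoc _ (1 / (n : ℝ)), one_div_mul_cancel (by linarith)]
      linarith
    · simpa using (tendsto_const_nhds (x := θ * (Real.log 2 - R - L))).sub
        ((tendsto_const_nhds (x := θ * Real.log 2)).mul tendsto_one_div_atTop_nhds_zero_nat)
end
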